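/- The image of the function f_1 in the universal quotient (ind_K^G st)/(T) is nonzero, but it does not generate (ind_K^G st)/(T) as a representation of G. -/

import Mathlib

open scoped Classical

noncomputable section

namespace U21

/-- The arithmetic setting: `E` is the unramified quadratic extension of a non-archimedean
local field `F` of odd residue characteristic `p`, with residue field of `F` of cardinality
`q = p ^ fdeg`.  The field `E` is encoded through its valuation subring `O = o_E`, a
uniformizer `ϖ`, the maximal ideal `mI` (so that `p_E^k` is `ϖ ^ k * O`), and the nontrivial
`F`-automorphism `conj` of `E` (which induces the `q`-power Frobenius on the residue field
of `E`, of cardinality `q ^ 2`). -/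
structure Setting where
  p : ℕ
  q : ℕ
  fdeg : ℕ
  hp : p.Prime
  hodd : p ≠ 2
  hfdeg : 0 < fdeg
  hq : q = p ^ fdeg
  E : Type
  [fieldE : Field E]
  conj : E →+* E
  conj_invol : ∀ x, conj (conj x) = x
  conj_ne : conj ≠ RingHom.id E
  O : Subring E
  val_ring : ∀ x : E, x ≠ 0 → x ∈ O ∨ x⁻¹ ∈ O
  conj_O : ∀ x, x ∈ O → conj x ∈ O
  ϖ : E
  unif_mem : ϖ ∈ O
  unif_ne : ϖ ≠ 0
  unif_conj : conj ϖ = ϖ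
  unif_not_unit : ¬ IsUnit (⟨ϖ, unif_mem⟩ : O)
  disc : ∀ x : E, x ≠ 0 → ∃ (n : ℤ) (u : Oˣ), x = (u : O) * ϖ ^ n
  mI : Ideal O
  hmI : ∀ x : O, x ∈ mI ↔ ∃ y ∈ O, (x : E) = ϖ * y
  [fin_res : Fintype (O ⧸ mI)]
  card_res : Fintype.card (O ⧸ mI) = q ^ 2
  res_frob : ∀ x : O, Ideal.Quotient.mk mI ⟨conj x, conj_O x x.2⟩ = (Ideal.Quotient.mk mI x) ^ q
  complete : ∀ a : ℕ → E,
    (∀ k : ℕ, ∃ N, ∀ m ≥ N, ∀ n ≥ N, ∃ w ∈ O, a m - a n = ϖ ^ k * w) →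
    ∃ L : E, ∀ k : ℕ, ∃ N, ∀ n ≥ N, ∃ w ∈ O, a n - L = ϖ ^ k * w

attribute [instance] Setting.fieldE Setting.fin_res

namespace Setting

variable (S : Setting)

/-- 3×3 matrices over `E`. -/
abbrev M3 := Matrix (Fin 3) (Fin 3) S.E

/-- The antidiagonal matrix `β` of the Hermitian form. -/
def betaM : S.M3 := !![0,0,1;0,1,0;1,0,0]

/-- The fractional ideal `p_E ^ k ⊆ E` (for `k : ℤ`). -/
def pE (k : ℤ) : Set S.E := {z | ∃ w ∈ S.O, z = S.ϖ ^ k * w}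

/-- The unramified unitary group `G = U(2,1)(E/F)`, as a subgroup of `GL₃(E)`:
`g ∈ G` iff `g.transpose * β * conj g = β`. -/
def Gsub : Subgroup (Matrix.GeneralLinearGroup (Fin 3) S.E) where
  carrier := {g | ((g : S.M3)).transpose * S.betaM * ((g : S.M3).map S.conj) = S.betaM}
  one_mem' := by
    simp [Matrix.map_one (⇑S.conj) (map_zero S.conj) (map_one S.conj)]
  mul_mem' := by
    intro a b ha hb
    simp only [Set.mem_setOf_eq, Units.val_mul, Matrix.transpose_mul, Matrix.map_mul] at ha hb ⊢
    calc ((b : S.M3)).transpose * ((a : S.M3)).transpose * S.betaM * ((a : S.M3).map S.conj * (b : S.M3).map S.conj)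
        = ((b : S.M3)).transpose * (((a : S.M3)).transpose * S.betaM * (a : S.M3).map S.conj) * ((b : S.M3).map S.conj) := by
          simp only [mul_assoc]
      _ = S.betaM := by rw [ha]; exact hb
  inv_mem' := by
    intro a ha
    simp only [Set.mem_setOf_eq] at ha ⊢
    have hA : IsUnit ((a : S.M3)) := a.isUnit
    have hdet : IsUnit ((a : S.M3)).det := (Matrix.isUnit_iff_isUnit_det _).mp hA
    have hAc : IsUnit (((a : S.M3)).map ⇑S.conj) := by
      rw [← RingHom.mapMatrix_apply]; exact hA.map _
    have hdetc : IsUnit ((((a : S.M3)).map ⇑S.conj).det) := (Matrix.isUnit_iff_isUnit_det _).mp hAc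
    have hdetT : IsUnit ((((a : S.M3)).transpose).det) := by rw [Matrix.det_transpose]; exact hdet
    have hmapinv : ((a : S.M3)⁻¹).map ⇑S.conj = (((a : S.M3)).map ⇑S.conj)⁻¹ := by
      symm
      apply Matrix.inv_eq_left_inv
      rw [← Matrix.map_mul, Matrix.nonsing_inv_mul _ hdet,
        Matrix.map_one (⇑S.conj) (map_zero S.conj) (map_one S.conj)]
    rw [Matrix.coe_units_inv, Matrix.transpose_nonsing_inv, hmapinv]
    conv_lhs => rw [← ha]
    calc (((a:S.M3)).transpose)⁻¹ * (((a:S.M3)).transpose * S.betaM * ((a:S.M3)).map ⇑S.conj) * (((a:S.M3)).map ⇑S.conj)⁻¹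
        = (((a:S.M3)).transpose)⁻¹ * ((a:S.M3)).transpose * S.betaM *
            (((a:S.M3)).map ⇑S.conj * (((a:S.M3)).map ⇑S.conj)⁻¹) := by simp only [mul_assoc]
      _ = S.betaM := by
          rw [Matrix.nonsing_inv_mul _ hdetT, Matrix.mul_nonsing_inv _ hdetc, one_mul, mul_one]

/-- The group `G = U(2,1)(E/F)`. -/
abbrev GG := ↥S.Gsub

/-- The matrix of an element of `G`. -/
def mat (g : S.GG) : S.M3 := ((g : Matrix.GeneralLinearGroup (Fin 3) S.E) : S.M3)

/-- The upper unipotent matrix `n(x,y)`. -/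
def nM (x y : S.E) : S.M3 := !![1, x, y; 0, 1, -S.conj x; 0, 0, 1]

/-- The lower unipotent matrix `n'(x,y)`. -/
def n'M (x y : S.E) : S.M3 := !![1, 0, 0; x, 1, 0; y, -S.conj x, 1]

/-- The diagonal matrix `h(x) = diag(x, -x̄x⁻¹, x̄⁻¹)`. -/
def hM (x : S.E) : S.M3 := !![x, 0, 0; 0, -S.conj x * x⁻¹, 0; 0, 0, (S.conj x)⁻¹]

/-- The subgroup `N` of `G` (unipotent radical of the upper triangular Borel), as a set. -/
def Nset : Set S.GG := {g | ∃ x y : S.E, x * S.conj x + y + S.conj y = 0 ∧ S.mat g = S.nM x y}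

/-- The subgroup `N_k = {n(x,y) : y ∈ p_E^k}`, as a set. -/
def Nk (k : ℤ) : Set S.GG :=
  {g | ∃ x y : S.E, x * S.conj x + y + S.conj y = 0 ∧ y ∈ S.pE k ∧ S.mat g = S.nM x y}

/-- The subgroup `N'` of `G`, as a set. -/
def N'set : Set S.GG := {g | ∃ x y : S.E, x * S.conj x + y + S.conj y = 0 ∧ S.mat g = S.n'M x y}

/-- The subgroup `N'_k = {n'(x,y) : y ∈ p_E^k}`, as a set. -/
def N'k (k : ℤ) : Set S.GG :=
  {g | ∃ x y : S.E, x * S.conj x + y + S.conj y = 0 ∧ y ∈ S.pE k ∧ S.mat g = S.n'M x y}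

/-- The diagonal subgroup `H` of `G`, as a set. -/
def Hset : Set S.GG := {g | ∃ a b c : S.E, S.mat g = !![a,0,0;0,b,0;0,0,c]}

/-- The hyperspecial maximal compact subgroup `K₀ = G ∩ GL₃(o_E)`, as a set. -/
def K0set : Set S.GG := {g | ∀ i j, S.mat g i j ∈ S.O}

/-- The special (non-hyperspecial) maximal compact subgroup `K₁`, as a set. -/
def K1set : Set S.GG :=
  {g | S.mat g 0 0 ∈ S.O ∧ S.mat g 0 1 ∈ S.O ∧ S.mat g 0 2 ∈ S.pE (-1) ∧
       S.mat g 1 0 ∈ S.pE 1 ∧ S.mat g 1 1 ∈ S.O ∧ S.mat g 1 2 ∈ S.O ∧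
       S.mat g 2 0 ∈ S.pE 1 ∧ S.mat g 2 1 ∈ S.pE 1 ∧ S.mat g 2 2 ∈ S.O}

/-- The Iwahori subgroup `I_{K₀}` (preimage of the Borel of `Γ_{K₀}`), as a set. -/
def IK0 : Set S.GG :=
  {g | g ∈ S.K0set ∧ S.mat g 1 0 ∈ S.pE 1 ∧ S.mat g 2 0 ∈ S.pE 1 ∧ S.mat g 2 1 ∈ S.pE 1}

/-- The pro-p Iwahori subgroup `I_{1,K₀}`, as a set. -/
def I1K0 : Set S.GG :=
  {g | g ∈ S.IK0 ∧ S.mat g 0 0 - 1 ∈ S.pE 1 ∧ S.mat g 1 1 - 1 ∈ S.pE 1 ∧ S.mat g 2 2 - 1 ∈ S.pE 1}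

/-- The opposite pro-p Iwahori subgroup `I'_{1,K₀}`, as a set. -/
def I1'K0 : Set S.GG :=
  {g | g ∈ S.K0set ∧ S.mat g 0 1 ∈ S.pE 1 ∧ S.mat g 0 2 ∈ S.pE 1 ∧ S.mat g 1 2 ∈ S.pE 1 ∧
       S.mat g 0 0 - 1 ∈ S.pE 1 ∧ S.mat g 1 1 - 1 ∈ S.pE 1 ∧ S.mat g 2 2 - 1 ∈ S.pE 1}

/-- The maximal normal pro-p subgroup `K₀¹` of `K₀` (principal congruence subgroup), as a set. -/
def Kone0 : Set S.GG := {g | ∀ i j, S.mat g i j - (1 : S.M3) i j ∈ S.pE 1}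

/-- The Iwahori subgroup `I_{K₁}`, as a set. -/
def IK1 : Set S.GG := {g | g ∈ S.K1set ∧ S.mat g 2 0 ∈ S.pE 2}

/-- The pro-p Iwahori subgroup `I_{1,K₁}`, as a set. -/
def I1K1 : Set S.GG :=
  {g | g ∈ S.IK1 ∧ S.mat g 0 0 - 1 ∈ S.pE 1 ∧ S.mat g 1 1 - 1 ∈ S.pE 1 ∧ S.mat g 2 2 - 1 ∈ S.pE 1}

/-- The opposite pro-p Iwahori subgroup `I'_{1,K₁}`, as a set. -/
def I1'K1 : Set S.GG :=
  {g | g ∈ S.K1set ∧ S.mat g 0 2 ∈ S.O ∧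
       S.mat g 0 0 - 1 ∈ S.pE 1 ∧ S.mat g 1 1 - 1 ∈ S.pE 1 ∧ S.mat g 2 2 - 1 ∈ S.pE 1}

/-- The maximal normal pro-p subgroup `K₁¹` of `K₁`, as a set. -/
def Kone1 : Set S.GG :=
  {g | g ∈ S.K1set ∧ S.mat g 0 2 ∈ S.O ∧ S.mat g 2 0 ∈ S.pE 2 ∧
       S.mat g 0 0 - 1 ∈ S.pE 1 ∧ S.mat g 1 1 - 1 ∈ S.pE 1 ∧ S.mat g 2 2 - 1 ∈ S.pE 1}

/-- The congruence subgroup of level `n` (used to express smoothness), as a set. -/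
def cong (n : ℕ) : Set S.GG := {g | ∀ i j, S.mat g i j - (1 : S.M3) i j ∈ S.pE n}

def alphaM : S.M3 := !![S.ϖ⁻¹, 0, 0; 0, 1, 0; 0, 0, S.ϖ]

def alphaMinv : S.M3 := !![S.ϖ, 0, 0; 0, 1, 0; 0, 0, S.ϖ⁻¹]

lemma alpha_mul_inv : S.alphaM * S.alphaMinv = 1 := by
  ext i j
  fin_cases i <;> fin_cases j <;>
    simp [alphaM, alphaMinv, Matrix.mul_apply, Fin.sum_univ_three, Matrix.one_apply,
      Matrix.vecHead, Matrix.vecTail, inv_mul_cancel₀ S.unif_ne, mul_inv_cancel₀ S.unif_ne]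

lemma alpha_inv_mul : S.alphaMinv * S.alphaM = 1 := by
  ext i j
  fin_cases i <;> fin_cases j <;>
    simp [alphaM, alphaMinv, Matrix.mul_apply, Fin.sum_univ_three, Matrix.one_apply,
      Matrix.vecHead, Matrix.vecTail, inv_mul_cancel₀ S.unif_ne, mul_inv_cancel₀ S.unif_ne]

def alphaU : Matrix.GeneralLinearGroup (Fin 3) S.E :=
  ⟨S.alphaM, S.alphaMinv, S.alpha_mul_inv, S.alpha_inv_mul⟩

lemma alphaU_mem : S.alphaU ∈ S.Gsub := by
  show ((S.alphaU : S.M3)).transpose * S.betaM * ((S.alphaU : S.M3).map S.conj) = S.betaM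
  have : (S.alphaU : S.M3) = S.alphaM := rfl
  rw [this]
  ext i j
  fin_cases i <;> fin_cases j <;>
    simp [alphaM, betaM, Matrix.mul_apply, Fin.sum_univ_three, Matrix.map_apply,
      Matrix.transpose_apply, Matrix.vecHead, Matrix.vecTail, map_inv₀, S.unif_conj,
      inv_mul_cancel₀ S.unif_ne, mul_inv_cancel₀ S.unif_ne]

/-- The element `α = diag(ϖ⁻¹, 1, ϖ)` of `G`. -/
def alphaE : S.GG := ⟨S.alphaU, S.alphaU_mem⟩

lemma beta_mul_beta : S.betaM * S.betaM = 1 := by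
  ext i j
  fin_cases i <;> fin_cases j <;>
    simp [betaM, Matrix.mul_apply, Fin.sum_univ_three, Matrix.one_apply,
      Matrix.vecHead, Matrix.vecTail]

def betaU : Matrix.GeneralLinearGroup (Fin 3) S.E :=
  ⟨S.betaM, S.betaM, S.beta_mul_beta, S.beta_mul_beta⟩

lemma betaU_mem : S.betaU ∈ S.Gsub := by
  show ((S.betaU : S.M3)).transpose * S.betaM * ((S.betaU : S.M3).map S.conj) = S.betaM
  have : (S.betaU : S.M3) = S.betaM := rfl
  rw [this]
  ext i j
  fin_cases i <;> fin_cases j <;>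
    simp [betaM, Matrix.mul_apply, Fin.sum_univ_three, Matrix.map_apply, Matrix.transpose_apply,
      Matrix.vecHead, Matrix.vecTail]

/-- The element `β` of `G`. -/
def betaE : S.GG := ⟨S.betaU, S.betaU_mem⟩

/-- The element `β' = β * α⁻¹` of `G`. -/
def betaPr : S.GG := S.betaE * S.alphaE⁻¹

/-- A finite set `U` is a set of representatives for the cosets `A/B`. -/
def IsReps (A B : Set S.GG) (U : Finset S.GG) : Prop :=
  (↑U : Set S.GG) ⊆ A ∧ ∀ a ∈ A, ∃! u, u ∈ U ∧ a⁻¹ * u ∈ B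

/-- The residue field `k_E` of `E`. -/
abbrev kE := S.O ⧸ S.mI

/-- The residue map `o_E → k_E`. -/
def resmap : S.O →+* S.kE := Ideal.Quotient.mk S.mI

/-- The group `L_{q³} = {(x,t) ∈ k_E² : x x̄ + t + t̄ = 0}` (where `x̄ = x^q`). -/
def Lbig : Set (S.kE × S.kE) := {z | z.1 * z.1 ^ S.q + z.2 + z.2 ^ S.q = 0}

/-- The group `L_q = {(0,t) ∈ k_E² : t + t̄ = 0}`. -/
def Lsmall : Set (S.kE × S.kE) := {z | z.1 = 0 ∧ z.2 + z.2 ^ S.q = 0}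

/-- `L_{q^t}` for `t ∈ {1,3}`. -/
def Lof (t : ℕ) : Set (S.kE × S.kE) := if t = 3 then S.Lbig else S.Lsmall

end Setting

/-- A choice of one of the two maximal compact open subgroups `K ∈ {K₀, K₁}` of `G`,
together with its maximal normal pro-p subgroup `K¹`, the (pro-p) Iwahori subgroups
`I_K ⊇ I_{1,K}`, the opposite pro-p Iwahori `I'_{1,K}`, the element
`β_K ∈ K ∩ {β, β'}`, and the integers `n_K, m_K, t_K`. -/
structure Chamber (S : Setting) where
  K : Subgroup S.GG
  KoneS : Set S.GG
  IK : Set S.GG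
  I1 : Set S.GG
  I1' : Set S.GG
  βK : S.GG
  nK : ℤ
  mK : ℤ
  tK : ℕ
  cases :
    ((K : Set S.GG) = S.K0set ∧ KoneS = S.Kone0 ∧ IK = S.IK0 ∧ I1 = S.I1K0 ∧ I1' = S.I1'K0 ∧
      βK = S.betaE ∧ nK = 0 ∧ mK = 1 ∧ tK = 3) ∨
    ((K : Set S.GG) = S.K1set ∧ KoneS = S.Kone1 ∧ IK = S.IK1 ∧ I1 = S.I1K1 ∧ I1' = S.I1'K1 ∧
      βK = S.betaPr ∧ nK = -1 ∧ mK = 2 ∧ tK = 1)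

namespace Chamber

variable {S : Setting} (C : Chamber S)

/-- `H₀ = H ∩ I_K`. -/
def H0 : Set S.GG := S.Hset ∩ C.IK

/-- `H₁ = H ∩ I_{1,K}`. -/
def H1 : Set S.GG := S.Hset ∩ C.I1

end Chamber

section RepTheory

variable {S : Setting} (C : Chamber S)
variable (𝔽 : Type) [Field 𝔽]

section Generic

variable {G₀ : Type} [Monoid G₀] {V : Type} [AddCommGroup V] [Module 𝔽 V]

/-- A submodule is invariant under a representation. -/
def Invt (ρ : Representation 𝔽 G₀ V) (Ssub : Submodule 𝔽 V) : Prop :=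
  ∀ g v, v ∈ Ssub → ρ g v ∈ Ssub

/-- The subrepresentation generated by a vector (the span of its orbit). -/
def orbitSpan (ρ : Representation 𝔽 G₀ V) (v : V) : Submodule 𝔽 V :=
  Submodule.span 𝔽 {w | ∃ g, w = ρ g v}

/-- The subrepresentation generated by a vector under a subset `A` of the group. -/
def orbitSpanOn (ρ : Representation 𝔽 G₀ V) (A : Set G₀) (v : V) : Submodule 𝔽 V :=
  Submodule.span 𝔽 {w | ∃ g ∈ A, w = ρ g v}

/-- The quotient of a representation by an invariant submodule `N` is irreducible:
equivalently (by the lattice correspondence), `N ≠ ⊤` and any invariant submodule lying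
between `N` and `⊤` equals `N` or `⊤`. -/
def QuotientIrreducible (ρ : Representation 𝔽 G₀ V) (N : Submodule 𝔽 V) : Prop :=
  N ≠ ⊤ ∧ ∀ Ssub : Submodule 𝔽 V, Invt 𝔽 ρ Ssub → N ≤ Ssub → Ssub = N ∨ Ssub = ⊤

/-- The submodule of vectors invariant under all elements of the subset `A`. -/
def invariantsOn (ρ : Representation 𝔽 G₀ V) (A : Set G₀) : Submodule 𝔽 V where
  carrier := {v | ∀ g ∈ A, ρ g v = v}
  add_mem' := by
    intro a b ha hb g hg
    rw [map_add, ha g hg, hb g hg]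
  zero_mem' := by
    intro g hg
    rw [map_zero]
  smul_mem' := by
    intro c a ha g hg
    rw [map_smul, ha g hg]

/-- The space `Hom_G(ρ₁, ρ₂)` of equivariant linear maps, as a submodule of the linear maps. -/
def EquivHomSub {V₂ : Type} [AddCommGroup V₂] [Module 𝔽 V₂]
    (ρ₁ : Representation 𝔽 G₀ V) (ρ₂ : Representation 𝔽 G₀ V₂) :
    Submodule 𝔽 (V →ₗ[𝔽] V₂) where
  carrier := {φ | ∀ g x, φ (ρ₁ g x) = ρ₂ g (φ x)}
  add_mem' := by
    intro a b ha hb g x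
    simp only [LinearMap.add_apply, ha g x, hb g x, map_add]
  zero_mem' := by
    intro g x
    simp only [LinearMap.zero_apply, map_zero]
  smul_mem' := by
    intro c a ha g x
    simp only [LinearMap.smul_apply, ha g x, map_smul]

end Generic

section Weight

variable (W : Type) [AddCommGroup W] [Module 𝔽 W]
variable (σ : Representation 𝔽 ↥C.K W)

/-- Extension of `σ` to all of `G` (by `1` outside `K`); used to avoid coercion issues. -/
def sigma' : S.GG → Module.End 𝔽 W := fun g => if h : g ∈ C.K then σ ⟨g, h⟩ else 1

/-- `σ` is a weight of `K`: an irreducible smooth representation of `K` over `𝔽`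
factoring through `Γ_K = K / K¹` (automatically finite dimensional). -/
def IsWeight : Prop :=
  Nontrivial W ∧ FiniteDimensional 𝔽 W ∧
  (∀ Ssub : Submodule 𝔽 W, (∀ (k : ↥C.K) (w : W), w ∈ Ssub → σ k w ∈ Ssub) → Ssub = ⊥ ∨ Ssub = ⊤) ∧
  (∀ (g : S.GG) (hg : g ∈ C.K), g ∈ C.KoneS → σ ⟨g, hg⟩ = LinearMap.id)

/-- `σ` is one dimensional of the form `χ ∘ det`. -/
def IsDetWeight : Prop :=
  Module.finrank 𝔽 W = 1 ∧
  ∃ c : S.E → 𝔽, ∀ (g : S.GG) (hg : g ∈ C.K) (w : W), σ ⟨g, hg⟩ w = c ((S.mat g).det) • w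

/-- `j_σ : σ → σ` is the composition of the coinvariant projection `σ → σ_{I'_{1,K}}`
with the inverse of the natural isomorphism `σ^{I_{1,K}} ≅ σ_{I'_{1,K}}`:
it restricts to the identity on `σ^{I_{1,K}}` and kills the augmentation part of
`σ` with respect to `I'_{1,K}`. -/
def IsJ (jσ : W →ₗ[𝔽] W) : Prop :=
  (∀ w : W, (∀ g ∈ C.I1, sigma' C 𝔽 W σ g w = w) → jσ w = w) ∧
  (∀ (w : W) (g : S.GG), g ∈ C.I1' → jσ (sigma' C 𝔽 W σ g w - w) = 0)

/-- The defining conditions of the compact induction `ind_K^G σ`: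
`K`-equivariance on the left and compact support (finitely many cosets `K g`). -/
def IndCarrier : Set (S.GG → W) :=
  {f | (∀ (k : S.GG) (hk : k ∈ C.K) (g : S.GG), f (k * g) = σ ⟨k, hk⟩ (f g)) ∧
       ∃ s : Finset S.GG, ∀ g : S.GG, f g ≠ 0 → ∃ k ∈ C.K, ∃ t ∈ s, g = k * t}

/-- The compact induction `ind_K^G σ`, as a submodule of `G → W`. -/
def IndSub : Submodule 𝔽 (S.GG → W) where
  carrier := IndCarrier C 𝔽 W σ
  add_mem' := by
    rintro f g ⟨hf1, sf, hf2⟩ ⟨hg1, sg, hg2⟩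
    refine ⟨fun k hk x => by simp [hf1 k hk x, hg1 k hk x], sf ∪ sg, fun x hx => ?_⟩
    by_cases h : f x ≠ 0
    · obtain ⟨k, hk, t, ht, rfl⟩ := hf2 x h
      exact ⟨k, hk, t, Finset.mem_union_left _ ht, rfl⟩
    · push_neg at h
      have hgx : g x ≠ 0 := by
        intro h0
        apply hx
        simp [Pi.add_apply, h, h0]
      obtain ⟨k, hk, t, ht, rfl⟩ := hg2 x hgx
      exact ⟨k, hk, t, Finset.mem_union_right _ ht, rfl⟩
  zero_mem' := ⟨fun k hk g => by simp, ∅, fun g hg => absurd rfl hg⟩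
  smul_mem' := by
    rintro c f ⟨hf1, sf, hf2⟩
    refine ⟨fun k hk g => by simp [hf1 k hk g], sf, fun x hx => ?_⟩
    refine hf2 x ?_
    intro h0
    apply hx
    simp [h0]

lemma indAct_mem (g : S.GG) {f : S.GG → W} (hf : f ∈ IndCarrier C 𝔽 W σ) :
    (fun x => f (x * g)) ∈ IndCarrier C 𝔽 W σ := by
  obtain ⟨h1, s, h2⟩ := hf
  refine ⟨fun k hk x => ?_, s.image (· * g⁻¹), ?_⟩
  · show f (k * x * g) = _
    rw [mul_assoc]
    exact h1 k hk (x * g)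
  intro x hx
  obtain ⟨k, hk, t, ht, hxg⟩ := h2 (x * g) hx
  refine ⟨k, hk, t * g⁻¹, Finset.mem_image_of_mem _ ht, ?_⟩
  rw [← mul_assoc, ← hxg, mul_assoc, mul_inv_cancel, mul_one]

/-- The representation of `G` on `ind_K^G σ` by right translation. -/
def indRep : Representation 𝔽 S.GG ↥(IndSub C 𝔽 W σ) where
  toFun g :=
    { toFun := fun f => ⟨fun x => (f : S.GG → W) (x * g), indAct_mem C 𝔽 W σ g f.2⟩
      map_add' := fun f1 f2 => Subtype.ext (funext fun x => rfl)
      map_smul' := fun c f => Subtype.ext (funext fun x => rfl) }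
  map_one' := LinearMap.ext fun f => Subtype.ext (funext fun x => by simp [mul_one])
  map_mul' g h := LinearMap.ext fun f => Subtype.ext (funext fun x => by simp [mul_assoc])

/-- The function `[g, v] ∈ ind_K^G σ`: supported on `K g⁻¹`, with value `v` at `g⁻¹`. -/
def stdFn (g : S.GG) (v : W) : S.GG → W :=
  fun x => if h : x * g ∈ C.K then σ ⟨x * g, h⟩ v else 0

/-- The characterization of the family `f_n` (`n ∈ ℤ`) of `I_{1,K}`-invariant elements of
`ind_K^G σ`: `f_n` is supported on `K α⁻ⁿ I_{1,K}` and has value at `α⁻ⁿ` equal to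
`σ(β_K) v₀` for `n > 0` and `v₀` for `n ≤ 0`, where `v₀` is a fixed nonzero vector of
`σ^{I_{1,K}}`. -/
def IsFFamily (v0 : W) (ff : ℤ → ↥(IndSub C 𝔽 W σ)) : Prop :=
  v0 ≠ 0 ∧ (∀ g ∈ C.I1, sigma' C 𝔽 W σ g v0 = v0) ∧
  (∀ (n : ℤ) (g : S.GG), g ∈ C.I1 → indRep C 𝔽 W σ g (ff n) = ff n) ∧
  (∀ (n : ℤ) (x : S.GG), (ff n : S.GG → W) x ≠ 0 →
    ∃ k ∈ C.K, ∃ i ∈ C.I1, x = k * S.alphaE ^ (-n) * i) ∧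
  (∀ n : ℤ, 0 < n → (ff n : S.GG → W) (S.alphaE ^ (-n)) = sigma' C 𝔽 W σ C.βK v0) ∧
  (∀ n : ℤ, n ≤ 0 → (ff n : S.GG → W) (S.alphaE ^ (-n)) = v0)

/-- The characterization of the Hecke operator `T ∈ End_G(ind_K^G σ)`:
it is `G`-equivariant and satisfies
`T [1, v] = ∑_{u ∈ N_{n_K}/N_{n_K+2}} [u α⁻¹, j_σ σ(u⁻¹) v]
  + ∑_{u ∈ N_{n_K+1}/N_{n_K+2}} [β_K u α⁻¹, j_σ σ(β_K) v]`. -/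
def IsHeckeT (jσ : W →ₗ[𝔽] W) (T : Module.End 𝔽 ↥(IndSub C 𝔽 W σ)) : Prop :=
  (∀ (g : S.GG) (x : ↥(IndSub C 𝔽 W σ)),
    T (indRep C 𝔽 W σ g x) = indRep C 𝔽 W σ g (T x)) ∧
  (∀ (v : W) (x : ↥(IndSub C 𝔽 W σ)), (x : S.GG → W) = stdFn C 𝔽 W σ 1 v →
    ∀ (U2 U1 : Finset S.GG),
      S.IsReps (S.Nk C.nK) (S.Nk (C.nK + 2)) U2 →
      S.IsReps (S.Nk (C.nK + 1)) (S.Nk (C.nK + 2)) U1 →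
      ((T x : S.GG → W)) =
        (∑ u ∈ U2, stdFn C 𝔽 W σ (u * S.alphaE⁻¹) (jσ (sigma' C 𝔽 W σ u⁻¹ v))) +
        ∑ u ∈ U1, stdFn C 𝔽 W σ (C.βK * u * S.alphaE⁻¹) (jσ (sigma' C 𝔽 W σ C.βK v)))

/-- The eigencharacter `χ_σ` of `H₀/H₁` afforded by the (one-dimensional) space
`σ^{I_{1,K}}` with chosen basis vector `v₀`. -/
def IsChi (v0 : W) (χ : S.GG → 𝔽) : Prop :=
  (∀ h ∈ C.H0, sigma' C 𝔽 W σ h v0 = χ h • v0)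

/-- Right translation on functions `K → 𝔽` (the action on a (finite) principal series). -/
def PSact (k : ↥C.K) (f : ↥C.K → 𝔽) : ↥C.K → 𝔽 := fun x => f (x * k)

/-- The (inflation to `K` of the) finite principal series `Ind_𝔹^{Γ_K} χ`:
functions on `K`, invariant under right translation by `K¹`, left `I_{1,K}`-invariant and
left `(H₀, χ)`-equivariant. -/
def PSchiSub (χ : S.GG → 𝔽) : Submodule 𝔽 (↥C.K → 𝔽) where
  carrier := {f | (∀ b : ↥C.K, (b : S.GG) ∈ C.I1 → ∀ x, f (b * x) = f x) ∧
                  (∀ h : ↥C.K, (h : S.GG) ∈ C.H0 → ∀ x, f (h * x) = χ (h : S.GG) * f x) ∧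
                  (∀ z : ↥C.K, (z : S.GG) ∈ C.KoneS → ∀ x, f (x * z) = f x)}
  add_mem' := by
    rintro f g ⟨hf1, hf2, hf3⟩ ⟨hg1, hg2, hg3⟩
    exact ⟨fun b hb x => by simp [hf1 b hb x, hg1 b hb x],
           fun h hh x => by simp [hf2 h hh x, hg2 h hh x, mul_add],
           fun z hz x => by simp [hf3 z hz x, hg3 z hz x]⟩
  zero_mem' := ⟨fun b hb x => rfl, fun h hh x => by simp, fun z hz x => rfl⟩
  smul_mem' := by
    rintro c f ⟨hf1, hf2, hf3⟩
    refine ⟨fun b hb x => by simp [hf1 b hb x], fun h hh x => ?_, fun z hz x => by simp [hf3 z hz x]⟩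
    simp only [Pi.smul_apply, hf2 h hh x, smul_eq_mul]
    ring

/-- The principal series `Ind_𝔹^{Γ_K} 1` for the trivial character. -/
def PS1sub : Submodule 𝔽 (↥C.K → 𝔽) := PSchiSub C 𝔽 (fun _ => 1)

/-- `σ_{st}` is the Steinberg weight `st = (Ind_𝔹^{Γ_K} 1)/1`: there is a surjective
`K`-equivariant linear map from `Ind_𝔹^{Γ_K} 1` to it whose kernel is exactly the
constant functions. -/
def IsSteinberg {Wst : Type} [AddCommGroup Wst] [Module 𝔽 Wst]
    (σst : Representation 𝔽 ↥C.K Wst) : Prop :=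
  ∃ φ : ↥(PS1sub C 𝔽) →ₗ[𝔽] Wst, Function.Surjective φ ∧
    (∀ f : ↥(PS1sub C 𝔽), φ f = 0 ↔ ∃ c : 𝔽, (f : ↥C.K → 𝔽) = fun _ => c) ∧
    (∀ (k : ↥C.K) (f f' : ↥(PS1sub C 𝔽)),
      (f' : ↥C.K → 𝔽) = PSact C 𝔽 k (f : ↥C.K → 𝔽) → φ f' = σst k (φ f))

/-- `σ` is isomorphic to a twist of the Steinberg weight by a character. -/
def IsTwistSteinberg : Prop :=
  ∃ (c : ↥C.K →* 𝔽ˣ) (φ : ↥(PS1sub C 𝔽) →ₗ[𝔽] W), Function.Surjective φ ∧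
    (∀ f : ↥(PS1sub C 𝔽), φ f = 0 ↔ ∃ cc : 𝔽, (f : ↥C.K → 𝔽) = fun _ => cc) ∧
    (∀ (k : ↥C.K) (f f' : ↥(PS1sub C 𝔽)),
      (f' : ↥C.K → 𝔽) = PSact C 𝔽 k (f : ↥C.K → 𝔽) →
        φ f' = (c k : 𝔽) • σ k (φ f))

/-- The `K`-subrepresentation of the quotient `(ind_K^G σ) / (range T)` generated by the
image of a vector `v`. -/
def genQuot (T : Module.End 𝔽 ↥(IndSub C 𝔽 W σ)) (v : ↥(IndSub C 𝔽 W σ)) :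
    Submodule 𝔽 (↥(IndSub C 𝔽 W σ) ⧸ LinearMap.range T) :=
  Submodule.span 𝔽 {w | ∃ k ∈ C.K, w = Submodule.Quotient.mk (indRep C 𝔽 W σ k v)}

end Weight

/-- Smoothness of a representation of `G`: every vector is fixed by some congruence
subgroup (equivalently, has open stabilizer). -/
def SmoothRep {V : Type} [AddCommGroup V] [Module 𝔽 V] (ρ : Representation 𝔽 S.GG V) : Prop :=
  ∀ v : V, ∃ n : ℕ, ∀ g ∈ S.cong n, ρ g v = v

end RepTheory

end U21

namespace U21

section CosetSums

variable {G : Type*} [Group G]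

lemma apply_eq_of_inv_mul_mem {α : Type*} {K : Subgroup G} {b : G → α}
    (hb : ∀ h, ∀ k ∈ K, b (h * k) = b h) {x y : G} (hxy : x⁻¹ * y ∈ K) : b x = b y := by
  rw [← hb x _ hxy, mul_inv_cancel_left]

variable {R : Type*} [CommRing R]

/-- The sum of the coefficients of a finitely supported function over the translate `h X`. -/
def cosetSum (R : Type*) [CommRing R] (X : Set G) (h : G) : (G →₀ R) →ₗ[R] R :=
  Finsupp.linearCombination R (fun g => if h⁻¹ * g ∈ X then (1 : R) else 0)

/-- Right multiplication by the element `∑ l ∈ U, l` of the group algebra. -/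
def translateSum (R : Type*) [CommRing R] (U : Finset G) : (G →₀ R) →ₗ[R] (G →₀ R) :=
  ∑ l ∈ U, Finsupp.lmapDomain R R (· * l)

/-- `U` represents the left cosets of `K ⊓ L` in `K \ L`. -/
structure IsCosetReps (K L : Subgroup G) (U : Finset G) : Prop where
  mem : ∀ l ∈ U, l ∈ K ∧ l ∉ L
  existsUnique : ∀ x ∈ K, x ∉ L → ∃! l, l ∈ U ∧ l⁻¹ * x ∈ K ⊓ L

lemma cosetSum_single (X : Set G) (h g : G) (a : R) :
    cosetSum R X h (Finsupp.single g a) = if h⁻¹ * g ∈ X then a else 0 := by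
  simp [cosetSum]

lemma translateSum_single (U : Finset G) (g : G) (a : R) :
    translateSum R U (Finsupp.single g a) = ∑ l ∈ U, Finsupp.single (g * l) a := by
  simp [translateSum, LinearMap.sum_apply, Finsupp.mapDomain_single]

lemma exists_mem_support_of_cosetSum_ne_zero {X : Set G} {h : G} {c : G →₀ R}
    (hc : cosetSum R X h c ≠ 0) : ∃ g ∈ c.support, h⁻¹ * g ∈ X := by
  by_contra! H
  apply hc
  rw [cosetSum, Finsupp.linearCombination_apply, Finsupp.sum]
  exact Finset.sum_eq_zero fun g hg => by simp [H g hg]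

lemma IsCosetReps.sum_ite {K L : Subgroup G} {U : Finset G} (hU : IsCosetReps K L U)
    (x : G) (a : R) :
    (∑ l ∈ U, if l⁻¹ * x ∈ K ⊓ L then a else 0) = if x ∈ K ∧ x ∉ L then a else 0 := by
  split_ifs with hx
  · obtain ⟨l, ⟨hl, hlx⟩, hu⟩ := hU.existsUnique x hx.1 hx.2
    rw [Finset.sum_eq_single l]
    · simp only [hlx, if_true]
    · intro m hm hml
      rw [if_neg]
      exact fun h => hml (hu m ⟨hm, h⟩)
    · exact fun h => absurd hl h
  · refine Finset.sum_eq_zero fun l hl => if_neg fun h => hx ?_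
    obtain ⟨hK, hL⟩ := hU.mem l hl
    refine ⟨?_, fun hxL => hL ?_⟩
    · simpa using K.mul_mem hK h.1
    · simpa using L.mul_mem hxL (L.inv_mem h.2)

lemma IsCosetReps.cosetSum_eq {K L : Subgroup G} {U : Finset G} (hU : IsCosetReps K L U)
    (h : G) (c : G →₀ R) :
    cosetSum R (K : Set G) h c = cosetSum R (K ⊓ L : Subgroup G) h c +
      ∑ l ∈ U, cosetSum R (K ⊓ L : Subgroup G) (h * l) c := by
  induction c using Finsupp.induction_linear with
  | zero => simp
  | add f g hf hg => simp only [map_add, hf, hg, Finset.sum_add_distrib]; ring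
  | single g a =>
    have := hU.sum_ite (h⁻¹ * g) a
    simp only [cosetSum_single, SetLike.mem_coe, mul_inv_rev, mul_assoc] at this ⊢
    rw [this]
    by_cases h1 : h⁻¹ * g ∈ K <;> by_cases h2 : h⁻¹ * g ∈ L <;> simp [h1, h2, Subgroup.mem_inf]

lemma IsCosetReps.cosetSum_translateSum {K L : Subgroup G} {U : Finset G}
    (hU : IsCosetReps K L U) (h : G) (c : G →₀ R) :
    cosetSum R (K ⊓ L : Subgroup G) h (translateSum R U c) + cosetSum R (K ⊓ L : Subgroup G) h c =
      cosetSum R (K : Set G) h c := by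
  induction c using Finsupp.induction_linear with
  | zero => simp
  | add f g hf hg => simp only [map_add, ← hf, ← hg]; ring
  | single g a =>
    have := hU.sum_ite (g⁻¹ * h) a
    have e : ∀ l : G, h⁻¹ * (g * l) ∈ K ⊓ L ↔ l⁻¹ * (g⁻¹ * h) ∈ K ⊓ L := fun l => by
      rw [← (K ⊓ L).inv_mem_iff]; simp [mul_assoc]
    have e' : ∀ M : Subgroup G, g⁻¹ * h ∈ M ↔ h⁻¹ * g ∈ M := fun M => by
      rw [← M.inv_mem_iff]; simp
    simp only [translateSum_single, map_sum, cosetSum_single, SetLike.mem_coe, e]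
    rw [this]
    simp only [e']
    by_cases h1 : h⁻¹ * g ∈ K <;> by_cases h2 : h⁻¹ * g ∈ L <;> simp [h1, h2, Subgroup.mem_inf]

lemma cosetSum_translateSum_of_subset {K : Subgroup G} {U : Finset G} (hU : ∀ l ∈ U, l ∈ K)
    (hcard : (U.card : R) = 0) (h : G) (c : G →₀ R) :
    cosetSum R (K : Set G) h (translateSum R U c) = 0 := by
  induction c using Finsupp.induction_linear with
  | zero => simp
  | add f g hf hg => simp only [map_add, hf, hg, add_zero]
  | single g a =>
    simp only [translateSum_single, map_sum, cosetSum_single, SetLike.mem_coe, ← mul_assoc]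
    rw [Finset.sum_congr rfl fun l hl => by rw [Subgroup.mul_mem_cancel_right K (hU l hl)]]
    simp [hcard]

/-- Vertices of type `K` of the tree, seen from an end stabilised by `P` with height function
`ht`: each has two distinct neighbours of type `L` all of whose other neighbours are further
away from that end. -/
structure Descends (K L P : Subgroup G) (ht : G → ℤ) : Prop where
  ht_mul : ∀ p ∈ P, ∀ r ∈ P, ht (p * r) = ht p + ht r
  iwasawa : ∀ g, ∃ p ∈ P, p⁻¹ * g ∈ K
  ht_compact : ∀ p ∈ P, p ∈ K → ht p = 0
  children : ∃ s₁ ∈ K, ∃ s₂ ∈ K, s₁⁻¹ * s₂ ∉ L ∧ ∀ l ∈ L, l ∉ K →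
    (∃ p ∈ P, 0 < ht p ∧ p⁻¹ * (s₁ * l) ∈ K) ∧ (∃ p ∈ P, 0 < ht p ∧ p⁻¹ * (s₂ * l) ∈ K)

lemma Descends.eq_zero {K L P : Subgroup G} {ht : G → ℤ} (D : Descends K L P ht) {U : Finset G}
    (hU : IsCosetReps L K U) {b : G → R} (hb : ∀ h, ∀ k ∈ K, b (h * k) = b h) (T : Finset G)
    (hT : ∀ h, b h ≠ 0 → ∃ t ∈ T, h⁻¹ * t ∈ K)
    (hsum : ∀ h, h ∉ L → b h + ∑ l ∈ U, b (h * l) = 0) (h : G) : b h = 0 := by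
  by_contra hne
  choose pp hpP hpK using D.iwasawa
  let V : Set ℤ := {n | ∃ p ∈ P, b p ≠ 0 ∧ ht p = n}
  have hVfin : V.Finite := by
    refine (T.image fun t => ht (pp t)).finite_toSet.subset ?_
    rintro n ⟨p, hp, hbp, rfl⟩
    obtain ⟨t, htT, ht'⟩ := hT p hbp
    refine Finset.mem_coe.2 (Finset.mem_image.2 ⟨t, htT, ?_⟩)
    have h1 : p⁻¹ * pp t ∈ K := by
      have := K.mul_mem ht' (K.inv_mem (hpK t))
      simpa [mul_assoc] using this
    have h2 := D.ht_compact _ (P.mul_mem (P.inv_mem hp) (hpP t)) h1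
    have h3 := D.ht_mul p hp _ (P.mul_mem (P.inv_mem hp) (hpP t))
    rw [mul_inv_cancel_left] at h3
    omega
  have hVne : V.Nonempty := by
    refine ⟨_, pp h, hpP h, ?_, rfl⟩
    rwa [apply_eq_of_inv_mul_mem hb (hpK h)]
  obtain ⟨n, ⟨p, hp, hbp, rfl⟩, hmax⟩ := Set.exists_max_image V id hVfin hVne
  obtain ⟨s₁, hs₁, s₂, hs₂, hs, hch⟩ := D.children
  have key : ∀ s ∈ K, (∀ l ∈ L, l ∉ K → ∃ p ∈ P, 0 < ht p ∧ p⁻¹ * (s * l) ∈ K) →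
      p * s ∈ L := by
    intro s hsK hsl
    by_contra hnL
    have h0 := hsum _ hnL
    rw [hb _ _ hsK, Finset.sum_eq_zero, add_zero] at h0
    · exact hbp h0
    intro l hl
    obtain ⟨r, hr, hr0, hrK⟩ := hsl l (hU.mem l hl).1 (hU.mem l hl).2
    by_contra hne'
    have h1 : b (p * r) = b (p * s * l) := apply_eq_of_inv_mul_mem hb (by
      simpa [mul_assoc] using hrK)
    have h2 := hmax _ ⟨p * r, P.mul_mem hp hr, by rwa [h1], rfl⟩
    have h3 := D.ht_mul p hp r hr
    simp only [id] at h2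
    omega
  have h1 := key s₁ hs₁ fun l hl hlK => (hch l hl hlK).1
  have h2 := key s₂ hs₂ fun l hl hlK => (hch l hl hlK).2
  apply hs
  have := L.mul_mem (L.inv_mem h1) h2
  simpa [mul_assoc] using this

lemma exists_mem_support_of_cosetSum_inf_ne_zero {K L : Subgroup G} {c : G →₀ R} (h : G)
    (hc : cosetSum R (K ⊓ L : Subgroup G) h c ≠ 0) : ∃ t ∈ c.support, h⁻¹ * t ∈ K :=
  let ⟨t, ht, h⟩ := exists_mem_support_of_cosetSum_ne_zero hc
  ⟨t, ht, h.1⟩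

lemma Descends.single_sub_translateSum_not_invariant [Nontrivial R] {K L P : Subgroup G}
    {ht : G → ℤ} (D : Descends K L P ht) {U : Finset G} (hU : IsCosetReps L K U)
    (hcard : (U.card : R) = 0) (d : G →₀ R)
    (hinv : ∀ h, ∀ k ∈ K, cosetSum R (K ⊓ L : Subgroup G) (h * k)
      (Finsupp.single 1 1 - translateSum R U d) =
        cosetSum R (K ⊓ L : Subgroup G) h (Finsupp.single 1 1 - translateSum R U d)) : False := by
  have hL : ∀ h, cosetSum R (L : Set G) h (Finsupp.single 1 1 - translateSum R U d) =
      if h ∈ L then 1 else 0 := fun h => by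
    rw [map_sub, cosetSum_translateSum_of_subset (fun l hl => (hU.mem l hl).1) hcard, sub_zero,
      cosetSum_single]
    simp
  have hdec := fun h => hU.cosetSum_eq h (Finsupp.single 1 1 - translateSum R U d)
  rw [inf_comm] at hdec
  have h0 := D.eq_zero (b := fun h => cosetSum R (K ⊓ L : Subgroup G) h
    (Finsupp.single 1 1 - translateSum R U d)) hU hinv _
    (fun h => exists_mem_support_of_cosetSum_inf_ne_zero h)
    fun h hh => by rw [← hdec, hL, if_neg hh]
  have h1 := hdec 1
  rw [hL, if_pos L.one_mem] at h1
  simp only [h0, Finset.sum_const_zero, add_zero] at h1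
  exact one_ne_zero h1

lemma Descends.translateSum_single_sub_not_invariant [Nontrivial R] {K L P P' : Subgroup G}
    {ht ht' : G → ℤ} (D : Descends K L P ht) (D' : Descends L K P' ht') {U V : Finset G}
    (hU : IsCosetReps L K U) (hUcard : (U.card : R) = 0)
    (hV : IsCosetReps K L V) (hVcard : (V.card : R) = 0) (d : G →₀ R)
    (hinv : ∀ h, ∀ k ∈ K, cosetSum R (K ⊓ L : Subgroup G) (h * k)
      (translateSum R U (Finsupp.single 1 1 - translateSum R V d)) =
        cosetSum R (K ⊓ L : Subgroup G) h
          (translateSum R U (Finsupp.single 1 1 - translateSum R V d))) : False := by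
  set e := Finsupp.single 1 1 - translateSum R V d with he
  have hdec := fun h => hU.cosetSum_eq h (translateSum R U e)
  have htr := fun h => hU.cosetSum_translateSum h e
  rw [inf_comm] at hdec htr
  have h0 := D.eq_zero (b := fun h => cosetSum R (K ⊓ L : Subgroup G) h (translateSum R U e))
    hU hinv _ (fun h => exists_mem_support_of_cosetSum_inf_ne_zero h)
    fun h hh => by
      rw [← hdec, cosetSum_translateSum_of_subset (fun l hl => (hU.mem l hl).1) hUcard]
  simp only [h0, zero_add] at htr
  have hK : ∀ h, cosetSum R (K : Set G) h e = if h ∈ K then 1 else 0 := fun h => by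
    rw [he, map_sub, cosetSum_translateSum_of_subset (fun l hl => (hV.mem l hl).1) hVcard,
      sub_zero, cosetSum_single]
    simp
  have hdec' := fun h => hV.cosetSum_eq h e
  have h0' := D'.eq_zero (b := fun h => cosetSum R (K ⊓ L : Subgroup G) h e) hV
    (fun h k hk => by
      simp only [htr]
      simp only [cosetSum]
      congr 2
      funext g
      simp only [mul_inv_rev, mul_assoc, SetLike.mem_coe, L.mul_mem_cancel_left (L.inv_mem hk)])
    e.support (fun h hh => by
      rw [inf_comm] at hh
      exact exists_mem_support_of_cosetSum_inf_ne_zero h hh)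
    fun h hh => by rw [← hdec', hK, if_neg hh]
  have h1 := hdec' 1
  rw [hK, if_pos K.one_mem] at h1
  simp only [h0', Finset.sum_const_zero, add_zero] at h1
  exact one_ne_zero h1

end CosetSums

namespace Setting

variable (S : Setting)

section Valuation

lemma mem_pE_iff {k : ℤ} {x : S.E} : x ∈ S.pE k ↔ S.ϖ ^ (-k) * x ∈ S.O := by
  constructor
  · rintro ⟨w, hw, rfl⟩
    rwa [zpow_neg, inv_mul_cancel_left₀ (zpow_ne_zero _ S.unif_ne)]
  · intro h
    refine ⟨_, h, ?_⟩
    rw [zpow_neg, mul_inv_cancel_left₀ (zpow_ne_zero _ S.unif_ne)]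

lemma zero_mem_pE (k : ℤ) : (0 : S.E) ∈ S.pE k := by
  simp [mem_pE_iff, S.O.zero_mem]

variable {S}

lemma add_mem_pE {k : ℤ} {x y : S.E} (hx : x ∈ S.pE k) (hy : y ∈ S.pE k) : x + y ∈ S.pE k := by
  rw [mem_pE_iff] at *
  rw [mul_add]
  exact S.O.add_mem hx hy

lemma neg_mem_pE {k : ℤ} {x : S.E} (hx : x ∈ S.pE k) : -x ∈ S.pE k := by
  rw [mem_pE_iff] at *
  rw [mul_neg]
  exact S.O.neg_mem hx

lemma sub_mem_pE {k : ℤ} {x y : S.E} (hx : x ∈ S.pE k) (hy : y ∈ S.pE k) : x - y ∈ S.pE k := by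
  rw [sub_eq_add_neg]
  exact add_mem_pE hx (neg_mem_pE hy)

lemma mul_mem_pE {k l : ℤ} {x y : S.E} (hx : x ∈ S.pE k) (hy : y ∈ S.pE l) :
    x * y ∈ S.pE (k + l) := by
  rw [mem_pE_iff] at *
  rw [neg_add, zpow_add₀ S.unif_ne, mul_mul_mul_comm]
  exact S.O.mul_mem hx hy

lemma unif_zpow_mem_pE (k : ℤ) : S.ϖ ^ k ∈ S.pE k := by
  rw [mem_pE_iff, ← zpow_add₀ S.unif_ne]
  simp [S.O.one_mem]

lemma mem_pE_zero {x : S.E} : x ∈ S.pE 0 ↔ x ∈ S.O := by simp [mem_pE_iff]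

lemma unif_zpow_mem {k : ℤ} (hk : 0 ≤ k) : S.ϖ ^ k ∈ S.O := by
  lift k to ℕ using hk
  rw [zpow_natCast]
  exact S.O.pow_mem S.unif_mem k

lemma pE_mono {k l : ℤ} (hkl : k ≤ l) {x : S.E} (hx : x ∈ S.pE l) : x ∈ S.pE k := by
  rw [mem_pE_iff] at *
  have h : -k = (l - k) + -l := by ring
  rw [h, zpow_add₀ S.unif_ne, mul_assoc]
  exact S.O.mul_mem (unif_zpow_mem (by omega)) hx

lemma conj_zpow (k : ℤ) : S.conj (S.ϖ ^ k) = S.ϖ ^ k := by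
  rw [map_zpow₀, S.unif_conj]

lemma conj_mem_pE {k : ℤ} {x : S.E} (hx : x ∈ S.pE k) : S.conj x ∈ S.pE k := by
  rw [mem_pE_iff] at *
  have := S.conj_O _ hx
  rwa [map_mul, conj_zpow] at this

lemma one_mem_pE {k : ℤ} (hk : k ≤ 0) : (1 : S.E) ∈ S.pE k :=
  pE_mono hk (mem_pE_zero.2 S.O.one_mem)

lemma unif_zpow_mem_pE_iff {k n : ℤ} : S.ϖ ^ n ∈ S.pE k ↔ k ≤ n := by
  refine ⟨fun h => ?_, fun h => pE_mono h (unif_zpow_mem_pE n)⟩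
  by_contra! hlt
  have h1 : S.ϖ ^ n ∈ S.pE (n + 1) := pE_mono (by omega) h
  rw [mem_pE_iff, ← zpow_add₀ S.unif_ne] at h1
  have h2 : -(n + 1) + n = -1 := by ring
  rw [h2, zpow_neg_one] at h1
  refine S.unif_not_unit ⟨⟨⟨S.ϖ, S.unif_mem⟩, ⟨S.ϖ⁻¹, h1⟩, ?_, ?_⟩, rfl⟩ <;>
  · ext
    simp [S.unif_ne]

lemma exists_val (x : S.E) (hx : x ≠ 0) : ∃ n : ℤ, ∀ k, x ∈ S.pE k ↔ k ≤ n := by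
  obtain ⟨n, u, rfl⟩ := S.disc x hx
  refine ⟨n, fun k => ?_⟩
  have hinv : (((u⁻¹ : S.Oˣ) : S.O) : S.E) * ((u : S.O) : S.E) = 1 := by
    exact congrArg Subtype.val u.inv_mul
  rw [← unif_zpow_mem_pE_iff]
  constructor
  · intro h
    have := mul_mem_pE (mem_pE_zero.2 ((u⁻¹ : S.Oˣ) : S.O).2) h
    rwa [← mul_assoc, hinv, one_mul, zero_add] at this
  · intro h
    have := mul_mem_pE (mem_pE_zero.2 (u : S.O).2) h
    rwa [zero_add] at this

/-- The normalised valuation of `E`, with value `0` at `0`. -/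
def val (x : S.E) : ℤ := if hx : x ≠ 0 then (exists_val x hx).choose else 0

lemma mem_pE_iff_val {x : S.E} (hx : x ≠ 0) {k : ℤ} : x ∈ S.pE k ↔ k ≤ val x := by
  rw [val, dif_pos hx]
  exact (exists_val x hx).choose_spec k

lemma val_eq_iff {x : S.E} (hx : x ≠ 0) {n : ℤ} :
    val x = n ↔ x ∈ S.pE n ∧ x ∉ S.pE (n + 1) := by
  rw [mem_pE_iff_val hx, mem_pE_iff_val hx]
  omega

lemma unif_zpow_mul_mem_pE {x : S.E} {n k : ℤ} : S.ϖ ^ n * x ∈ S.pE k ↔ x ∈ S.pE (k - n) := by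
  rw [mem_pE_iff, mem_pE_iff, ← mul_assoc, ← zpow_add₀ S.unif_ne, show -k + n = -(k - n) by ring]

lemma inv_mem_of_val_eq_zero {x : S.E} (hx : x ≠ 0) (h : val x = 0) : x⁻¹ ∈ S.O := by
  obtain ⟨n, u, hu⟩ := S.disc x hx
  have huu : (((u⁻¹ : S.Oˣ) : S.O) : S.E) * ((u : S.O) : S.E) = 1 :=
    congrArg Subtype.val u.inv_mul
  have h2 : x ∈ S.pE n := hu ▸ by
    have := mul_mem_pE (mem_pE_zero.2 (u : S.O).2) (unif_zpow_mem_pE (S := S) n)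
    rwa [zero_add] at this
  rw [mem_pE_iff_val hx, h] at h2
  rw [hu, mul_inv, ← zpow_neg, ← eq_inv_of_mul_eq_one_left huu]
  exact S.O.mul_mem ((u⁻¹ : S.Oˣ) : S.O).2 (unif_zpow_mem (by omega))

lemma val_unif_zpow (n : ℤ) : val (S.ϖ ^ n) = n := by
  rw [val_eq_iff (zpow_ne_zero _ S.unif_ne), unif_zpow_mem_pE_iff, unif_zpow_mem_pE_iff]
  omega

lemma val_unif_zpow_mul {x : S.E} (hx : x ≠ 0) (n : ℤ) : val (S.ϖ ^ n * x) = n + val x := by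
  have hne : S.ϖ ^ n * x ≠ 0 := mul_ne_zero (zpow_ne_zero _ S.unif_ne) hx
  rw [val_eq_iff hne, unif_zpow_mul_mem_pE, unif_zpow_mul_mem_pE, mem_pE_iff_val hx,
    mem_pE_iff_val hx]
  omega

lemma val_mul {x y : S.E} (hx : x ≠ 0) (hy : y ≠ 0) : val (x * y) = val x + val y := by
  set a := S.ϖ ^ (-val x) * x with ha
  have ha0 : a ≠ 0 := mul_ne_zero (zpow_ne_zero _ S.unif_ne) hx
  have hva : val a = 0 := by rw [ha, val_unif_zpow_mul hx]; ring
  have hainv := inv_mem_of_val_eq_zero ha0 hva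
  have haO : a ∈ S.pE 0 := by rw [mem_pE_iff_val ha0, hva]
  have key : val (a * y) = val y := by
    have h1 := mul_mem_pE haO ((mem_pE_iff_val hy).2 le_rfl)
    have h2 := mul_mem_pE (mem_pE_zero.2 hainv) ((mem_pE_iff_val (mul_ne_zero ha0 hy)).2 le_rfl)
    rw [inv_mul_cancel_left₀ ha0] at h2
    rw [mem_pE_iff_val (mul_ne_zero ha0 hy)] at h1
    rw [mem_pE_iff_val hy] at h2
    omega
  rw [ha, mul_assoc, val_unif_zpow_mul (mul_ne_zero hx hy)] at key
  omega

lemma val_inv {x : S.E} (hx : x ≠ 0) : val x⁻¹ = -val x := by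
  have h := val_mul hx (inv_ne_zero hx)
  rw [mul_inv_cancel₀ hx] at h
  have h1 : val (1 : S.E) = 0 := by simpa using val_unif_zpow (S := S) 0
  omega

lemma conj_ne_zero {x : S.E} (hx : x ≠ 0) : S.conj x ≠ 0 := by
  simpa using hx

lemma val_conj {x : S.E} (hx : x ≠ 0) : val (S.conj x) = val x := by
  have h : ∀ y : S.E, y ≠ 0 → val y ≤ val (S.conj y) := fun y hy => by
    rw [← mem_pE_iff_val (conj_ne_zero hy)]
    exact conj_mem_pE ((mem_pE_iff_val hy).2 le_rfl)
  have h1 := h x hx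
  have h2 := h _ (conj_ne_zero hx)
  rw [S.conj_invol] at h2
  omega

lemma mem_pE_of_mul_conj_mem {x : S.E} {k l : ℤ} (hkl : 2 * l ≤ k + 1)
    (h : x * S.conj x ∈ S.pE k) : x ∈ S.pE l := by
  by_cases hx : x = 0
  · rw [hx]; exact zero_mem_pE S l
  rw [mem_pE_iff_val (mul_ne_zero hx (conj_ne_zero hx)), val_mul hx (conj_ne_zero hx),
    val_conj hx] at h
  rw [mem_pE_iff_val hx]
  omega

lemma div_mem_pE {x y : S.E} {k l : ℤ} (hx : x ∈ S.pE k) (hy : y ≠ 0) (hyl : val y ≤ l) :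
    x / y ∈ S.pE (k - l) := by
  rw [div_eq_mul_inv]
  refine pE_mono ?_ (mul_mem_pE hx ((mem_pE_iff_val (inv_ne_zero hy)).2 le_rfl))
  rw [val_inv hy]
  omega

end Valuation

section Residue

variable {S}

lemma mem_mI_iff (x : S.O) : x ∈ S.mI ↔ (x : S.E) ∈ S.pE 1 := by
  rw [S.hmI]
  simp [pE]

instance mI_isPrime : S.mI.IsPrime := by
  refine Ideal.isPrime_iff.2 ⟨?_, fun {x y} hxy => ?_⟩
  · rw [Ne, Ideal.eq_top_iff_one, mem_mI_iff]
    intro h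
    have := (unif_zpow_mem_pE_iff (S := S) (k := 1) (n := 0)).1 (by simpa using h)
    omega
  · by_contra! h
    rw [mem_mI_iff, mem_mI_iff] at h
    rw [mem_mI_iff] at hxy
    have hx0 : (x : S.E) ≠ 0 := fun h0 => h.1 (by rw [h0]; exact zero_mem_pE S 1)
    have hy0 : (y : S.E) ≠ 0 := fun h0 => h.2 (by rw [h0]; exact zero_mem_pE S 1)
    rw [mem_pE_iff_val hx0, mem_pE_iff_val hy0] at h
    rw [Subring.coe_mul, mem_pE_iff_val (mul_ne_zero hx0 hy0), val_mul hx0 hy0] at hxy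
    omega

lemma natCast_p_mem : ((S.p : ℕ) : S.E) ∈ S.pE 1 := by
  have h : ((Fintype.card S.kE : ℕ) : S.kE) = 0 := Nat.cast_card_eq_zero S.kE
  rw [S.card_res, S.hq] at h
  push_cast at h
  have h2 : ((S.p : ℕ) : S.kE) = 0 := eq_zero_of_pow_eq_zero (eq_zero_of_pow_eq_zero h)
  have h3 : ((S.p : ℕ) : S.O) ∈ S.mI := by
    rw [← Ideal.Quotient.eq_zero_iff_mem]
    simpa using h2
  rw [mem_mI_iff] at h3
  simpa using h3

lemma two_notMem : (2 : S.E) ∉ S.pE 1 := by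
  intro h
  have hp : ¬ 2 ∣ S.p := fun h2 => S.hodd ((Nat.prime_dvd_prime_iff_eq Nat.prime_two S.hp).1 h2).symm
  have h1 : (S.p : S.E) = 2 * ((S.p / 2 : ℕ) : S.E) + 1 := by
    have : S.p = 2 * (S.p / 2) + 1 := by omega
    exact_mod_cast congrArg (Nat.cast (R := S.E)) this
  have h2 : (1 : S.E) ∈ S.pE 1 := by
    have h3 : (1 : S.E) = S.p - 2 * ((S.p / 2 : ℕ) : S.E) := by rw [h1]; ring
    rw [h3]
    refine sub_mem_pE natCast_p_mem ?_
    have := mul_mem_pE h (mem_pE_zero.2 (natCast_mem S.O (S.p / 2)))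
    rwa [add_zero] at this
  have := (unif_zpow_mem_pE_iff (S := S) (k := 1) (n := 0)).1 (by simpa using h2)
  omega

/-- There is a unit of `o_E` of trace zero. -/
lemma exists_trace_zero_unit : ∃ w : S.E, w ∈ S.O ∧ w ∉ S.pE 1 ∧ S.conj w = -w := by
  by_contra! H
  have hall : ∀ x : S.kE, x ^ S.q = x := by
    intro x
    obtain ⟨a, rfl⟩ := Ideal.Quotient.mk_surjective x
    rw [← S.res_frob a, Ideal.Quotient.eq, mem_mI_iff]
    by_contra hn
    refine H (S.conj a - a) (S.O.sub_mem (S.conj_O _ a.2) a.2) (by simpa using hn) ?_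
    rw [map_sub, S.conj_invol]
    ring
  have hq1 : 1 < S.q := by
    rw [S.hq]
    exact Nat.one_lt_pow S.hfdeg.ne' S.hp.one_lt
  have hlt : (Polynomial.X : Polynomial S.kE).natDegree <
      (Polynomial.X ^ S.q : Polynomial S.kE).natDegree := by
    rwa [Polynomial.natDegree_X_pow, Polynomial.natDegree_X]
  have hdeg : (Polynomial.X ^ S.q - Polynomial.X : Polynomial S.kE).natDegree = S.q := by
    rw [Polynomial.natDegree_sub_eq_left_of_natDegree_lt hlt, Polynomial.natDegree_X_pow]
  have hne : (Polynomial.X ^ S.q - Polynomial.X : Polynomial S.kE) ≠ 0 :=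
    Polynomial.ne_zero_of_natDegree_gt (hdeg.symm ▸ hq1)
  have hle := Polynomial.card_le_degree_of_subset_roots (p := (Polynomial.X ^ S.q - Polynomial.X :
    Polynomial S.kE)) (Z := Finset.univ) (fun x _ => by
      rw [Polynomial.mem_roots hne]
      simp [hall x])
  rw [hdeg, Finset.card_univ, S.card_res] at hle
  nlinarith

/-- A unit of `o_E` whose norm is congruent to `1` is congruent to an element of norm `1`. -/
lemma exists_norm_one {c : S.E} (hc : c ∈ S.O) (hn : c * S.conj c - 1 ∈ S.pE 1) :
    ∃ b : S.E, b ∈ S.O ∧ b * S.conj b = 1 ∧ c - b ∈ S.pE 1 := by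
  obtain ⟨z, hz, hz1, hzc⟩ : ∃ z : S.E, z ∈ S.O ∧ z ∉ S.pE 1 ∧ z - S.conj z * c ∈ S.pE 1 := by
    have key : ∀ w ∈ S.O, (w + c * S.conj w) - S.conj (w + c * S.conj w) * c ∈ S.pE 1 := by
      intro w hw
      have h : (w + c * S.conj w) - S.conj (w + c * S.conj w) * c =
          -((c * S.conj c - 1) * w) := by
        rw [map_add, map_mul, S.conj_invol]
        ring
      rw [h]
      have := mul_mem_pE hn (mem_pE_zero.2 hw)
      rw [add_zero] at this
      exact neg_mem_pE this
    have hO : ∀ w ∈ S.O, w + c * S.conj w ∈ S.O := fun w hw =>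
      S.O.add_mem hw (S.O.mul_mem hc (S.conj_O _ hw))
    by_cases h1 : (1 : S.E) + c * S.conj 1 ∈ S.pE 1
    · obtain ⟨w, hw, hw1, hwc⟩ := exists_trace_zero_unit (S := S)
      refine ⟨_, hO w hw, fun hmem => ?_, key w hw⟩
      rw [map_one, mul_one] at h1
      have h2 : w * 2 ∈ S.pE 1 := by
        have h3 : w * 2 = (w + c * S.conj w) + (1 + c) * w := by rw [hwc]; ring
        rw [h3]
        refine add_mem_pE hmem ?_
        have := mul_mem_pE h1 (mem_pE_zero.2 hw)
        rwa [add_zero] at this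
      have hw0 : w ≠ 0 := fun h0 => hw1 (by rw [h0]; exact zero_mem_pE S 1)
      have h20 : (2 : S.E) ≠ 0 := fun h0 => two_notMem (by rw [h0]; exact zero_mem_pE S 1)
      have h22 := two_notMem (S := S)
      rw [mem_pE_iff_val h20] at h22
      rw [mem_pE_iff_val hw0] at hw1
      rw [mem_pE_iff_val (mul_ne_zero hw0 h20), val_mul hw0 h20] at h2
      omega
    · exact ⟨_, hO 1 S.O.one_mem, h1, key 1 S.O.one_mem⟩
  have hz0 : z ≠ 0 := fun h0 => hz1 (by rw [h0]; exact zero_mem_pE S 1)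
  have hvz : val z = 0 := by
    rw [val_eq_iff hz0, mem_pE_zero]
    exact ⟨hz, hz1⟩
  have hcz0 := conj_ne_zero hz0
  have hcz : val (S.conj z) = 0 := by rw [val_conj hz0, hvz]
  have hczi := inv_mem_of_val_eq_zero hcz0 hcz
  refine ⟨z * (S.conj z)⁻¹, S.O.mul_mem hz hczi, ?_, ?_⟩
  · rw [map_mul, map_inv₀, S.conj_invol]
    field_simp
  · have h : c - z * (S.conj z)⁻¹ = -((z - S.conj z * c) * (S.conj z)⁻¹) := by
      field_simp
      ring
    rw [h]
    have := mul_mem_pE hzc (mem_pE_zero.2 hczi)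
    rw [add_zero] at this
    exact neg_mem_pE this

end Residue

end Setting

namespace Setting

variable {S : Setting}

section Unitary

lemma mat_mul (g h : S.GG) : S.mat (g * h) = S.mat g * S.mat h := rfl

lemma mat_one : S.mat 1 = 1 := rfl

lemma mat_injective : Function.Injective S.mat := fun _ _ h =>
  Subtype.ext (Units.ext h)

lemma mat_mul_apply (g h : S.GG) (i j : Fin 3) : S.mat (g * h) i j =
    S.mat g i 0 * S.mat h 0 j + S.mat g i 1 * S.mat h 1 j + S.mat g i 2 * S.mat h 2 j := by
  rw [mat_mul, Matrix.mul_apply, Fin.sum_univ_three]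

lemma transpose_mul_betaM_mul_apply (M : S.M3) (i j : Fin 3) :
    (M.transpose * S.betaM * M.map S.conj) i j =
      M 0 i * S.conj (M 2 j) + M 1 i * S.conj (M 1 j) + M 2 i * S.conj (M 0 j) := by
  simp [Matrix.mul_apply, Fin.sum_univ_three, betaM]
  ring

/-- The Hermitian relations between the columns of an element of `G`. -/
lemma mat_form (g : S.GG) (i j : Fin 3) :
    S.mat g 0 i * S.conj (S.mat g 2 j) + S.mat g 1 i * S.conj (S.mat g 1 j) +
      S.mat g 2 i * S.conj (S.mat g 0 j) = S.betaM i j := by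
  rw [← transpose_mul_betaM_mul_apply]
  exact congrFun (congrFun g.2 i) j

lemma form_inverse {M : S.M3} (h : M.transpose * S.betaM * M.map S.conj = S.betaM) :
    S.betaM * (M.map S.conj).transpose * S.betaM * M = 1 := by
  have h1 := congrArg (fun A : S.M3 => S.betaM * A.map S.conj) h
  have hb : S.betaM.map S.conj = S.betaM := by
    ext i j
    fin_cases i <;> fin_cases j <;> simp [betaM]
  have hM : (M.map S.conj).map S.conj = M := by
    ext i j
    simp [S.conj_invol]
  simp only [Matrix.map_mul, hb, hM, S.beta_mul_beta, Matrix.transpose_map] at h1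
  rw [← h1]
  simp only [mul_assoc]

/-- The element of `G` with a given matrix. -/
def ofMat (M : S.M3) (h : M.transpose * S.betaM * M.map S.conj = S.betaM) : S.GG :=
  ⟨⟨M, S.betaM * (M.map S.conj).transpose * S.betaM,
    mul_eq_one_comm.1 (form_inverse h), form_inverse h⟩, h⟩

lemma mat_ofMat (M : S.M3) (h) : S.mat (ofMat M h) = M := rfl

lemma mat_inv_apply (g : S.GG) (i j : Fin 3) :
    S.mat g⁻¹ i j = S.conj (S.mat g j.rev i.rev) := by
  have h2 : S.mat g⁻¹ = S.betaM * ((S.mat g).map S.conj).transpose * S.betaM := by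
    have h1 : S.mat g * S.mat g⁻¹ = 1 := by rw [← mat_mul, mul_inv_cancel, mat_one]
    exact (left_inv_eq_right_inv (form_inverse g.2) h1).symm
  rw [h2]
  fin_cases i <;> fin_cases j <;>
    simp [Matrix.mul_apply, Fin.sum_univ_three, betaM, Fin.rev, Matrix.vecMul, dotProduct]

end Unitary

section Levels

/-- The lattice of matrices whose `(i, j)` entry has valuation at least `(t * (i - j) + s) / 2`. -/
def levelSet (t s : ℤ) : Set S.M3 :=
  {m | ∀ i j : Fin 3, m i j ∈ S.pE ((t * (((i : ℕ) : ℤ) - ((j : ℕ) : ℤ)) + s + 1) / 2)}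

lemma levelSet_mul {t s r : ℤ} {a b : S.M3} (ha : a ∈ levelSet t s) (hb : b ∈ levelSet t r) :
    a * b ∈ levelSet t (s + r) := by
  intro i j
  rw [Matrix.mul_apply, Fin.sum_univ_three]
  have h : ∀ k : Fin 3, a i k * b k j ∈
      S.pE ((t * (((i : ℕ) : ℤ) - ((j : ℕ) : ℤ)) + (s + r) + 1) / 2) := by
    intro k
    refine pE_mono ?_ (mul_mem_pE (ha i k) (hb k j))
    have h1 : t * (((i : ℕ) : ℤ) - ((j : ℕ) : ℤ)) = t * (((i : ℕ) : ℤ) - ((k : ℕ) : ℤ)) +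
      t * (((k : ℕ) : ℤ) - ((j : ℕ) : ℤ)) := by ring
    rw [h1]
    omega
  exact add_mem_pE (add_mem_pE (h 0) (h 1)) (h 2)

lemma levelSet_add {t s : ℤ} {a b : S.M3} (ha : a ∈ levelSet t s) (hb : b ∈ levelSet t s) :
    a + b ∈ levelSet t s := fun i j => add_mem_pE (ha i j) (hb i j)

lemma levelSet_mono {t s r : ℤ} (h : s ≤ r) {a : S.M3} (ha : a ∈ levelSet t r) :
    a ∈ levelSet t s := fun i j => pE_mono (by omega) (ha i j)

lemma one_mem_levelSet (t : ℤ) : (1 : S.M3) ∈ levelSet t 0 := by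
  intro i j
  rw [Matrix.one_apply]
  split_ifs with h
  · rw [h]
    exact one_mem_pE (by norm_num)
  · exact zero_mem_pE S _

lemma coe_rev (i : Fin 3) : ((i.rev : ℕ) : ℤ) = 2 - ((i : ℕ) : ℤ) := by
  fin_cases i <;> rfl

variable (S) in
/-- The stabiliser in `G` of a point of an apartment of the tree, the points being indexed by the
integers; `t = 0` gives `K₀` and `t = 1` gives `K₁`. -/
def vertexGroup (t : ℤ) : Subgroup S.GG where
  carrier := {g | S.mat g ∈ levelSet t 0}
  one_mem' := one_mem_levelSet t
  mul_mem' {a b} ha hb := by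
    have := levelSet_mul ha hb
    rwa [add_zero, ← mat_mul] at this
  inv_mem' {a} ha i j := by
    rw [mat_inv_apply]
    have := conj_mem_pE (ha j.rev i.rev)
    rw [coe_rev, coe_rev] at this
    convert this using 3
    ring_nf

lemma mem_vertexGroup {t : ℤ} {g : S.GG} : g ∈ S.vertexGroup t ↔ S.mat g ∈ levelSet t 0 := Iff.rfl

lemma mem_levelSet_iff {t s : ℤ} {m : S.M3} : m ∈ levelSet t s ↔
    (m 0 0 ∈ S.pE ((s + 1) / 2) ∧ m 1 1 ∈ S.pE ((s + 1) / 2) ∧ m 2 2 ∈ S.pE ((s + 1) / 2)) ∧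
    (m 0 1 ∈ S.pE ((-t + s + 1) / 2) ∧ m 1 2 ∈ S.pE ((-t + s + 1) / 2)) ∧
    m 0 2 ∈ S.pE ((-2 * t + s + 1) / 2) ∧
    (m 1 0 ∈ S.pE ((t + s + 1) / 2) ∧ m 2 1 ∈ S.pE ((t + s + 1) / 2)) ∧
    m 2 0 ∈ S.pE ((2 * t + s + 1) / 2) := by
  simp only [levelSet, Set.mem_ofPred_eq, Fin.forall_fin_succ, IsEmpty.forall_iff, and_true]
  norm_num [mul_comm t 2]
  tauto

/-- An element of the stabiliser of `t` whose lower left entry is small also stabilises `t + 1`. -/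
lemma mem_vertexGroup_succ {t : ℤ} {g : S.GG} (hg : g ∈ S.vertexGroup t)
    (h : S.mat g 2 0 ∈ S.pE (t + 1)) : g ∈ S.vertexGroup (t + 1) := by
  have key : ∀ g : S.GG, g ∈ S.vertexGroup t → S.mat g 2 0 ∈ S.pE (t + 1) →
      S.mat g 1 0 ∈ S.pE ((t + 2) / 2) := by
    intro g hg h
    have h00 := (mem_levelSet_iff.1 hg).1.1
    refine mem_pE_of_mul_conj_mem (k := t + 1) (by omega) ?_
    have hf := mat_form g 0 0
    have hb : S.betaM 0 0 = 0 := rfl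
    rw [hb] at hf
    have h1 : S.mat g 1 0 * S.conj (S.mat g 1 0) =
        -(S.mat g 0 0 * S.conj (S.mat g 2 0)) - S.mat g 2 0 * S.conj (S.mat g 0 0) := by
      linear_combination hf
    rw [h1]
    refine sub_mem_pE (neg_mem_pE ?_) ?_
    · have := mul_mem_pE h00 (conj_mem_pE h)
      simpa using this
    · have := mul_mem_pE h (conj_mem_pE h00)
      simpa using this
  have h10 := key g hg h
  have h21 := key g⁻¹ (inv_mem hg) (by rw [mat_inv_apply]; exact conj_mem_pE h)
  rw [mat_inv_apply] at h21
  have h21' := conj_mem_pE h21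
  rw [S.conj_invol] at h21'
  obtain ⟨⟨a, b, c⟩, ⟨d, e⟩, f, -, -⟩ := mem_levelSet_iff.1 hg
  refine mem_levelSet_iff.2 ⟨⟨a, b, c⟩, ⟨pE_mono (by omega) d, pE_mono (by omega) e⟩,
    pE_mono (by omega) f, ⟨pE_mono (by omega) h10, pE_mono (by omega) h21'⟩,
    pE_mono (by omega) h⟩

end Levels

section Elements

variable (S) in
/-- The antidiagonal element fixing the point `t` of the apartment and reversing the apartment. -/
def reflection (t : ℤ) : S.GG :=
  ofMat !![0, 0, S.ϖ ^ (-t); 0, 1, 0; S.ϖ ^ t, 0, 0] (by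
    have h1 := zpow_ne_zero t S.unif_ne
    ext i j
    rw [transpose_mul_betaM_mul_apply]
    fin_cases i <;> fin_cases j <;> simp [betaM, S.unif_conj, h1])

variable (S) in
/-- The diagonal element `diag(ϖ⁻ᵗ, 1, ϖᵗ)`. -/
def translation (t : ℤ) : S.GG :=
  ofMat !![S.ϖ ^ (-t), 0, 0; 0, 1, 0; 0, 0, S.ϖ ^ t] (by
    have h1 := zpow_ne_zero t S.unif_ne
    ext i j
    rw [transpose_mul_betaM_mul_apply]
    fin_cases i <;> fin_cases j <;> simp [betaM, S.unif_conj, h1])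

lemma mat_reflection_mul (t : ℤ) (g : S.GG) (i j : Fin 3) :
    S.mat (S.reflection t * g) i j = S.ϖ ^ (t * (((i : ℕ) : ℤ) - 1)) * S.mat g i.rev j := by
  rw [mat_mul_apply, reflection, mat_ofMat]
  fin_cases i <;> simp [Fin.rev]

lemma mat_mul_reflection (t : ℤ) (g : S.GG) (i j : Fin 3) :
    S.mat (g * S.reflection t) i j = S.ϖ ^ (t * (1 - ((j : ℕ) : ℤ))) * S.mat g i j.rev := by
  rw [mat_mul_apply, reflection, mat_ofMat]
  fin_cases j <;> simp [Fin.rev, mul_comm]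

lemma reflection_mul_reflection (t s : ℤ) :
    S.reflection t * S.reflection s = S.translation (t - s) := by
  apply mat_injective
  ext i j
  rw [mat_reflection_mul, reflection, translation, mat_ofMat, mat_ofMat]
  fin_cases i <;> fin_cases j <;> simp [Fin.rev, zpow_sub₀ S.unif_ne] <;> field_simp

lemma translation_zero : S.translation 0 = 1 := by
  apply mat_injective
  ext i j
  rw [translation, mat_ofMat, mat_one]
  fin_cases i <;> fin_cases j <;> simp

lemma translation_mul_translation (t s : ℤ) :
    S.translation t * S.translation s = S.translation (t + s) := by
  apply mat_injective
  ext i j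
  rw [mat_mul_apply]
  simp only [translation, mat_ofMat]
  fin_cases i <;> fin_cases j <;> simp [zpow_add₀ S.unif_ne, mul_comm]

lemma translation_inv (t : ℤ) : (S.translation t)⁻¹ = S.translation (-t) := by
  rw [inv_eq_iff_mul_eq_one, translation_mul_translation, add_neg_cancel, translation_zero]

lemma reflection_mul_self (t : ℤ) : S.reflection t * S.reflection t = 1 := by
  rw [reflection_mul_reflection, sub_self, translation_zero]

lemma reflection_inv (t : ℤ) : (S.reflection t)⁻¹ = S.reflection t :=
  inv_eq_of_mul_eq_one_left (reflection_mul_self t)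

lemma translation_mul_reflection (t s : ℤ) :
    S.translation t * S.reflection s = S.reflection (t + s) := by
  have h := reflection_mul_reflection (S := S) (t + s) s
  rw [add_sub_cancel_right] at h
  rw [← h, mul_assoc, reflection_mul_self, mul_one]

lemma reflection_mul_translation (t s : ℤ) :
    S.reflection t * S.translation s = S.reflection (t - s) := by
  have h := reflection_mul_reflection (S := S) t (t - s)
  rw [sub_sub_cancel] at h
  rw [← h, ← mul_assoc, reflection_mul_self, one_mul]

lemma alphaE_eq : S.alphaE = S.translation 1 := by
  apply mat_injective
  show S.alphaM = _
  simp [translation, mat_ofMat, alphaM]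

lemma betaE_eq : S.betaE = S.reflection 0 := by
  apply mat_injective
  show S.betaM = _
  simp [reflection, mat_ofMat, betaM]

lemma betaPr_eq : S.betaPr = S.reflection 1 := by
  rw [betaPr, betaE_eq, alphaE_eq, translation_inv, reflection_mul_translation]
  norm_num

lemma reflection_mem (t : ℤ) : S.reflection t ∈ S.vertexGroup t := by
  have h1 := unif_zpow_mem_pE (S := S) t
  have h2 := unif_zpow_mem_pE (S := S) (-t)
  refine mem_levelSet_iff.2 ?_
  simp only [reflection, mat_ofMat, zero_add]
  simp [zero_mem_pE, one_mem_pE]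
  exact ⟨by simpa using pE_mono (by omega) h2, pE_mono (by omega) h1⟩

/-- Conjugation by a reflection permutes the point stabilisers. -/
lemma reflection_conj_mem_iff {t s : ℤ} {g : S.GG} :
    S.reflection t * g * S.reflection t ∈ S.vertexGroup (2 * t - s) ↔ g ∈ S.vertexGroup s := by
  have key : ∀ (s : ℤ) (g : S.GG), g ∈ S.vertexGroup s →
      S.reflection t * g * S.reflection t ∈ S.vertexGroup (2 * t - s) := by
    intro s g hg i j
    rw [mat_mul_reflection, mat_reflection_mul, unif_zpow_mul_mem_pE, unif_zpow_mul_mem_pE]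
    have h := hg i.rev j.rev
    rw [coe_rev, coe_rev] at h
    refine pE_mono ?_ h
    generalize ((i : ℕ) : ℤ) = i'
    generalize ((j : ℕ) : ℤ) = j'
    have e1 : (2 * t - s) * (i' - j') = 2 * (t * (i' - 1)) + 2 * (t * (1 - j')) +
      s * ((2 - i') - (2 - j')) := by ring
    rw [e1]
    omega
  refine ⟨fun h => ?_, key s g⟩
  have := key _ _ h
  have e1 : S.reflection t * (S.reflection t * g * S.reflection t) * S.reflection t =
      (S.reflection t * S.reflection t) * g * (S.reflection t * S.reflection t) := by
    simp only [mul_assoc]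
  rwa [e1, reflection_mul_self, one_mul, mul_one, sub_sub_cancel] at this

/-- Conjugation by a translation permutes the point stabilisers. -/
lemma translation_conj_mem_iff {t s : ℤ} {g : S.GG} :
    (S.translation t)⁻¹ * g * S.translation t ∈ S.vertexGroup (s - 2 * t) ↔
      g ∈ S.vertexGroup s := by
  have h1 : S.translation t = S.reflection t * S.reflection 0 := by
    rw [reflection_mul_reflection, sub_zero]
  have h2 : (S.translation t)⁻¹ * g * S.translation t =
      S.reflection 0 * (S.reflection t * g * S.reflection t) * S.reflection 0 := by
    rw [h1, mul_inv_rev, reflection_inv, reflection_inv]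
    simp only [mul_assoc]
  rw [h2, show s - 2 * t = 2 * 0 - (2 * t - s) by ring, reflection_conj_mem_iff,
    reflection_conj_mem_iff]

/-- The element `n(x, y)` of `G`. -/
def unip (x y : S.E) (h : x * S.conj x + y + S.conj y = 0) : S.GG :=
  ofMat (S.nM x y) (by
    ext i j
    rw [transpose_mul_betaM_mul_apply]
    fin_cases i <;> fin_cases j <;> simp [nM, betaM, S.conj_invol]
    linear_combination h)

lemma mat_unip (x y : S.E) (h) : S.mat (unip x y h) = S.nM x y := rfl

lemma unip_mem_Nset (x y : S.E) (h) : unip x y h ∈ S.Nset := ⟨x, y, h, rfl⟩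

lemma unip_mul (x y x' y' : S.E) (h h') : unip x y h * unip x' y' h' =
    unip (S := S) (x + x') (y + y' - x * S.conj x') (by
      simp only [map_add, map_sub, map_mul, S.conj_invol]
      linear_combination h + h') := by
  apply mat_injective
  rw [mat_mul, mat_unip, mat_unip, mat_unip]
  ext i j
  fin_cases i <;> fin_cases j <;>
    simp [nM, Matrix.mul_apply, Fin.sum_univ_three] <;> ring

lemma unip_inv (x y : S.E) (h) : (unip x y h)⁻¹ =
    unip (S := S) (-x) (S.conj y) (by simp only [map_neg, S.conj_invol]; linear_combination h) := by
  rw [inv_eq_iff_mul_eq_one, unip_mul]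
  apply mat_injective
  rw [mat_unip, mat_one]
  ext i j
  fin_cases i <;> fin_cases j <;> simp [nM]
  linear_combination h

variable (S) in
/-- The group `N` of upper triangular unipotent elements of `G`. -/
def unipotent : Subgroup S.GG where
  carrier := S.Nset
  one_mem' := ⟨0, 0, by simp, by
    rw [mat_one]; ext i j; fin_cases i <;> fin_cases j <;> simp [nM]⟩
  mul_mem' := by
    rintro a b ⟨x, y, h, ha⟩ ⟨x', y', h', hb⟩
    obtain rfl : a = unip x y h := mat_injective ha
    obtain rfl : b = unip x' y' h' := mat_injective hb
    rw [unip_mul]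
    exact unip_mem_Nset _ _ _
  inv_mem' := by
    rintro a ⟨x, y, h, ha⟩
    obtain rfl : a = unip x y h := mat_injective ha
    rw [unip_inv]
    exact unip_mem_Nset _ _ _

lemma unip_mem (x y : S.E) (h) : unip x y h ∈ S.unipotent := unip_mem_Nset x y h

lemma unip_mem_vertexGroup {x y : S.E} {h} {t : ℤ} :
    unip x y h ∈ S.vertexGroup t ↔ y ∈ S.pE (-t) := by
  rw [mem_vertexGroup, mem_levelSet_iff, mat_unip]
  simp only [nM, add_zero]
  constructor
  · rintro ⟨-, -, h2, -⟩
    simp at h2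
    exact pE_mono (by omega) h2
  · intro hy
    have hx : x ∈ S.pE ((-t + 1) / 2) := by
      refine mem_pE_of_mul_conj_mem (k := -t) (by omega) ?_
      have : x * S.conj x = -(y + S.conj y) := by linear_combination h
      rw [this]
      exact neg_mem_pE (add_mem_pE hy (conj_mem_pE hy))
    simp [zero_mem_pE, one_mem_pE]
    exact ⟨⟨hx, neg_mem_pE (conj_mem_pE hx)⟩, pE_mono (by omega) hy⟩

lemma mem_Nk_iff {k : ℤ} {g : S.GG} : g ∈ S.Nk k ↔ g ∈ S.unipotent ∧ g ∈ S.vertexGroup (-k) := by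
  constructor
  · rintro ⟨x, y, h, hy, hg⟩
    obtain rfl : g = unip x y h := mat_injective hg
    exact ⟨unip_mem x y h, unip_mem_vertexGroup.2 (by simpa using hy)⟩
  · rintro ⟨⟨x, y, h, hg⟩, hk⟩
    obtain rfl : g = unip x y h := mat_injective hg
    rw [unip_mem_vertexGroup, neg_neg] at hk
    exact ⟨x, y, h, hk, rfl⟩

/-- The filtration of `N` by the point stabilisers is strict. -/
lemma exists_central_unip (t : ℤ) : ∃ y : S.E, ∃ h : 0 * S.conj 0 + y + S.conj y = 0,
    unip 0 y h ∈ S.vertexGroup t ∧ unip 0 y h ∉ S.vertexGroup (t - 1) := by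
  obtain ⟨w, hw, hw1, hwc⟩ := exists_trace_zero_unit (S := S)
  refine ⟨S.ϖ ^ (-t) * w, ?_, ?_, ?_⟩
  · rw [map_mul, conj_zpow, hwc]
    ring
  · rw [unip_mem_vertexGroup, unif_zpow_mul_mem_pE, sub_self, mem_pE_zero]
    exact hw
  · rw [unip_mem_vertexGroup, unif_zpow_mul_mem_pE, show -(t - 1) - -t = 1 by ring]
    exact hw1

end Elements

section Decompositions

/-- If the ratio of the first and last entries of the first column of `g` is small, then the first
two entries of that column can be cleared by a unipotent element stabilising `t`. -/
lemma exists_unip_clear_column {t : ℤ} {g : S.GG} (hc : S.mat g 2 0 ≠ 0)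
    (ha : S.mat g 0 0 / S.mat g 2 0 ∈ S.pE (-t)) : ∃ u ∈ S.unipotent, u ∈ S.vertexGroup t ∧
      S.mat (u⁻¹ * g) 0 0 = 0 ∧ S.mat (u⁻¹ * g) 1 0 = 0 := by
  have hf := mat_form g 0 0
  rw [show S.betaM 0 0 = 0 from rfl] at hf
  have hc' := conj_ne_zero hc
  have hrel : (-S.conj (S.mat g 1 0 / S.mat g 2 0)) *
      S.conj (-S.conj (S.mat g 1 0 / S.mat g 2 0)) +
      S.mat g 0 0 / S.mat g 2 0 + S.conj (S.mat g 0 0 / S.mat g 2 0) = 0 := by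
    simp only [map_neg, S.conj_invol, map_div₀]
    field_simp
    linear_combination hf
  refine ⟨unip _ _ hrel, unip_mem _ _ _, unip_mem_vertexGroup.2 ha, ?_, ?_⟩
  · rw [unip_inv, mat_mul_apply, mat_unip]
    simp only [nM, map_div₀]
    simp
    field_simp
    linear_combination hf
  · rw [unip_inv, mat_mul_apply, mat_unip]
    simp [nM, S.conj_invol]
    field_simp
    ring

/-- The Bruhat decomposition of a point stabiliser. -/
lemma exists_bruhat {t : ℤ} {g : S.GG} (hg : g ∈ S.vertexGroup t)
    (hg' : g ∉ S.vertexGroup (t + 1)) : ∃ u ∈ S.unipotent, u ∈ S.vertexGroup t ∧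
      (u * S.reflection t)⁻¹ * g ∈ S.vertexGroup t ⊓ S.vertexGroup (t + 1) := by
  have h20 : S.mat g 2 0 ∉ S.pE (t + 1) := fun h => hg' (mem_vertexGroup_succ hg h)
  have hne : S.mat g 2 0 ≠ 0 := fun h0 => h20 (by rw [h0]; exact zero_mem_pE S _)
  have hval : val (S.mat g 2 0) ≤ t := by
    rw [mem_pE_iff_val hne] at h20
    omega
  have h00 : S.mat g 0 0 ∈ S.pE 0 := by simpa using (mem_levelSet_iff.1 hg).1.1
  have hdiv := div_mem_pE h00 hne hval
  rw [zero_sub] at hdiv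
  obtain ⟨u, hu, hut, hu0, -⟩ := exists_unip_clear_column hne hdiv
  refine ⟨u, hu, hut, ?_⟩
  have hmem : (u * S.reflection t)⁻¹ * g ∈ S.vertexGroup t :=
    mul_mem (inv_mem (mul_mem hut (reflection_mem t))) hg
  refine ⟨hmem, mem_vertexGroup_succ hmem ?_⟩
  rw [mul_inv_rev, reflection_inv, mul_assoc, mat_reflection_mul]
  have : (2 : Fin 3).rev = 0 := rfl
  rw [this, hu0, mul_zero]
  exact zero_mem_pE S _

/-- The Bruhat decomposition of the stabiliser of `t + 1`, from the point of view of `t`. -/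
lemma exists_bruhat_succ {t : ℤ} {g : S.GG} (hg : g ∈ S.vertexGroup (t + 1))
    (hg' : g ∉ S.vertexGroup t) : ∃ u ∈ S.unipotent, u ∈ S.vertexGroup (t - 1) ∧
      (S.reflection t * u * (S.translation 1)⁻¹)⁻¹ * g ∈
        S.vertexGroup t ⊓ S.vertexGroup (t + 1) := by
  rw [← reflection_conj_mem_iff (t := t)] at hg hg'
  rw [show 2 * t - (t + 1) = t - 1 by ring] at hg
  rw [show 2 * t - t = t - 1 + 1 by ring] at hg'
  obtain ⟨u, hu, hut, h1, h2⟩ := exists_bruhat hg hg'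
  have e : S.reflection t * ((S.reflection t * u * (S.translation 1)⁻¹)⁻¹ * g) * S.reflection t =
      (u * S.reflection (t - 1))⁻¹ * (S.reflection t * g * S.reflection t) := by
    have h3 : S.reflection (t - 1) = S.reflection t * S.translation 1 := by
      rw [reflection_mul_translation]
    rw [mul_inv_rev, mul_inv_rev, mul_inv_rev, reflection_inv, reflection_inv, h3, inv_inv]
    simp only [mul_assoc]
  rw [← e] at h1 h2
  refine ⟨u, hu, hut, ?_, ?_⟩
  · rw [show t - 1 + 1 = 2 * t - t by ring] at h2
    exact reflection_conj_mem_iff.1 h2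
  · have h1' : _ ∈ S.vertexGroup (t - 1) := h1
    rw [show t - 1 = 2 * t - (t + 1) by ring] at h1'
    exact reflection_conj_mem_iff.1 h1'

lemma borel_relations {g : S.GG} (h1 : S.mat g 1 0 = 0) (h2 : S.mat g 2 0 = 0) :
    S.mat g 0 0 ≠ 0 ∧ S.mat g 2 1 = 0 ∧ S.mat g 0 0 * S.conj (S.mat g 2 2) = 1 := by
  have hf := mat_form g 0 2
  rw [h1, h2, show S.betaM 0 2 = 1 from rfl, zero_mul, zero_mul, add_zero, add_zero] at hf
  have h0 : S.mat g 0 0 ≠ 0 := left_ne_zero_of_mul_eq_one hf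
  refine ⟨h0, ?_, hf⟩
  have hf' := mat_form g 0 1
  rw [h1, h2, show S.betaM 0 1 = 0 from rfl, zero_mul, zero_mul, add_zero, add_zero] at hf'
  simpa [h0] using hf'

variable (S) in
/-- The upper triangular subgroup of `G`. -/
def borel : Subgroup S.GG where
  carrier := {g | S.mat g 1 0 = 0 ∧ S.mat g 2 0 = 0}
  one_mem' := by simp [mat_one]
  mul_mem' {a b} ha hb := by
    obtain ⟨-, ha3, -⟩ := borel_relations ha.1 ha.2
    simp [mat_mul_apply, ha.1, ha.2, hb.1, hb.2]
  inv_mem' {a} ha := by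
    obtain ⟨-, ha3, -⟩ := borel_relations ha.1 ha.2
    have h1 : S.mat a⁻¹ 1 0 = S.conj (S.mat a 2 1) := mat_inv_apply a 1 0
    have h2 : S.mat a⁻¹ 2 0 = S.conj (S.mat a 2 0) := mat_inv_apply a 2 0
    exact ⟨by rw [h1, ha3, map_zero], by rw [h2, ha.2, map_zero]⟩

lemma unipotent_le_borel : S.unipotent ≤ S.borel := by
  rintro g ⟨x, y, h, hg⟩
  exact ⟨by rw [hg]; simp [nM], by rw [hg]; simp [nM]⟩

lemma translation_mem_borel (t : ℤ) : S.translation t ∈ S.borel := by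
  constructor <;> simp [translation, mat_ofMat]

/-- The Iwasawa decomposition. -/
lemma exists_iwasawa (t : ℤ) (g : S.GG) : ∃ k ∈ S.vertexGroup t, k * g ∈ S.borel := by
  by_cases hc : S.mat g 2 0 = 0
  · refine ⟨1, one_mem _, ?_⟩
    rw [one_mul]
    have hf := mat_form g 0 0
    rw [hc, map_zero, mul_zero, zero_mul, zero_add, add_zero, show S.betaM 0 0 = 0 from rfl] at hf
    exact ⟨by simpa using hf, hc⟩
  by_cases ha : S.mat g 0 0 / S.mat g 2 0 ∈ S.pE (-t)
  · obtain ⟨u, -, hut, h0, h1⟩ := exists_unip_clear_column hc ha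
    refine ⟨S.reflection t * u⁻¹, mul_mem (reflection_mem t) (inv_mem hut), ?_, ?_⟩
    · rw [mul_assoc, mat_reflection_mul, show (1 : Fin 3).rev = 1 from rfl, h1, mul_zero]
    · rw [mul_assoc, mat_reflection_mul, show (2 : Fin 3).rev = 0 from rfl, h0, mul_zero]
  · have ha0 : S.mat g 0 0 ≠ 0 := fun h0 => ha (by rw [h0, zero_div]; exact zero_mem_pE S _)
    rw [mem_pE_iff_val (div_ne_zero ha0 hc), div_eq_mul_inv,
      val_mul ha0 (inv_ne_zero hc), val_inv hc] at ha
    have e2 : S.mat (S.reflection 0 * g) 2 0 = S.mat g 0 0 := by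
      rw [mat_reflection_mul, show (2 : Fin 3).rev = 0 from rfl]
      simp
    have e0 : S.mat (S.reflection 0 * g) 0 0 = S.mat g 2 0 := by
      rw [mat_reflection_mul, show (0 : Fin 3).rev = 2 from rfl]
      simp
    obtain ⟨u, -, hut, h0, h1⟩ := exists_unip_clear_column (t := -t) (g := S.reflection 0 * g)
      (by rwa [e2]) (by
        rw [e2, e0, mem_pE_iff_val (div_ne_zero hc ha0), div_eq_mul_inv,
          val_mul hc (inv_ne_zero ha0), val_inv ha0]
        omega)
    have hk := (reflection_conj_mem_iff (t := 0)).2 (inv_mem hut)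
    rw [mul_zero, zero_sub, neg_neg] at hk
    refine ⟨_, hk, ?_, ?_⟩
    · rw [mul_assoc, mul_assoc, mat_reflection_mul, show (1 : Fin 3).rev = 1 from rfl, h1,
        mul_zero]
    · rw [mul_assoc, mul_assoc, mat_reflection_mul, show (2 : Fin 3).rev = 0 from rfl, h0,
        mul_zero]

lemma val_mat_mul_of_borel {p r : S.GG} (hp : p ∈ S.borel) (hr : r ∈ S.borel) :
    val (S.mat (p * r) 0 0) = val (S.mat p 0 0) + val (S.mat r 0 0) := by
  rw [mat_mul_apply, hr.1, hr.2, mul_zero, mul_zero, add_zero, add_zero,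
    val_mul (borel_relations hp.1 hp.2).1 (borel_relations hr.1 hr.2).1]

lemma val_mat_eq_zero {t : ℤ} {p : S.GG} (hp : p ∈ S.borel) (hpt : p ∈ S.vertexGroup t) :
    val (S.mat p 0 0) = 0 := by
  obtain ⟨h0, -, h1⟩ := borel_relations hp.1 hp.2
  have h2 : S.mat p 2 2 ≠ 0 := fun h => by
    rw [h, map_zero, mul_zero] at h1
    exact zero_ne_one h1
  obtain ⟨⟨a, -, b⟩, -⟩ := mem_levelSet_iff.1 hpt
  rw [mem_pE_iff_val h0] at a
  rw [mem_pE_iff_val h2] at b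
  have h3 := congrArg val h1
  rw [val_mul h0 (conj_ne_zero h2), val_conj h2,
    show val (1 : S.E) = 0 by simpa using val_unif_zpow (S := S) 0] at h3
  omega

lemma val_mat_unip_mul {u : S.GG} (hu : u ∈ S.unipotent) :
    val (S.mat (u * (S.translation 1)⁻¹) 0 0) = 1 := by
  obtain ⟨x, y, h, hg⟩ := hu
  rw [translation_inv, mat_mul_apply, hg, translation, mat_ofMat]
  simp [nM]
  simpa using val_unif_zpow (S := S) 1

lemma exists_borel_mul_mem (t : ℤ) (g : S.GG) : ∃ p ∈ S.borel, p⁻¹ * g ∈ S.vertexGroup t := by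
  obtain ⟨k, hk, hp⟩ := exists_iwasawa t g⁻¹
  refine ⟨_, inv_mem hp, ?_⟩
  rwa [inv_inv, inv_mul_cancel_right]

lemma unip_mul_translation_mem_borel {u : S.GG} (hu : u ∈ S.unipotent) :
    u * (S.translation 1)⁻¹ ∈ S.borel :=
  mul_mem (unipotent_le_borel hu) (inv_mem (translation_mem_borel 1))

lemma descends_vertexGroup (t : ℤ) : Descends (S.vertexGroup t) (S.vertexGroup (t + 1)) S.borel
    (fun g => val (S.mat g 0 0)) where
  ht_mul _ hp _ hr := val_mat_mul_of_borel hp hr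
  iwasawa := exists_borel_mul_mem t
  ht_compact _ hp hpt := val_mat_eq_zero hp hpt
  children := by
    obtain ⟨y, h, hv, hv'⟩ := exists_central_unip (S := S) t
    refine ⟨S.reflection t, reflection_mem t, unip 0 y h * S.reflection t,
      mul_mem hv (reflection_mem t), ?_, fun l hl hlt => ?_⟩
    · rw [reflection_inv, ← mul_assoc, show t + 1 = 2 * t - (t - 1) by ring,
        reflection_conj_mem_iff]
      exact hv'
    · obtain ⟨u, hu, -, hi⟩ := exists_bruhat_succ hl hlt
      replace hi := (Subgroup.mem_inf.1 hi).1
      have key : ∀ v ∈ S.unipotent, ∃ p ∈ S.borel, 0 < val (S.mat p 0 0) ∧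
          p⁻¹ * (v * S.reflection t * l) ∈ S.vertexGroup t := by
        intro v hv
        refine ⟨_, unip_mul_translation_mem_borel (mul_mem hv hu), ?_, ?_⟩
        · rw [val_mat_unip_mul (mul_mem hv hu)]
          exact one_pos
        · convert hi using 1
          simp only [mul_inv_rev, reflection_inv]
          group
      have h1 := key 1 (one_mem _)
      rw [one_mul] at h1
      exact ⟨h1, key _ (unip_mem _ _ _)⟩

lemma descends_vertexGroup_succ (t : ℤ) :
    Descends (S.vertexGroup (t + 1)) (S.vertexGroup t) S.borel (fun g => val (S.mat g 0 0)) where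
  ht_mul _ hp _ hr := val_mat_mul_of_borel hp hr
  iwasawa := exists_borel_mul_mem (t + 1)
  ht_compact _ hp hpt := val_mat_eq_zero hp hpt
  children := by
    obtain ⟨y, h, hv, hv'⟩ := exists_central_unip (S := S) (t + 1)
    rw [add_sub_cancel_right] at hv'
    refine ⟨1, one_mem _, unip 0 y h, hv, by simpa using hv', fun l hl hlt => ?_⟩
    obtain ⟨u, hu, -, hi⟩ := exists_bruhat hl hlt
    replace hi := (Subgroup.mem_inf.1 hi).2
    have key : ∀ v ∈ S.unipotent, ∃ p ∈ S.borel, 0 < val (S.mat p 0 0) ∧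
        p⁻¹ * (v * l) ∈ S.vertexGroup (t + 1) := by
      intro v hv
      refine ⟨_, unip_mul_translation_mem_borel (mul_mem hv hu), ?_, ?_⟩
      · rw [val_mat_unip_mul (mul_mem hv hu)]
        exact one_pos
      · have h2 := mul_mem (reflection_mem (t + 1)) hi
        convert h2 using 1
        rw [add_comm t 1, ← translation_mul_reflection]
        have h3 : S.reflection t * (u * S.reflection t)⁻¹ = u⁻¹ := by
          rw [mul_inv_rev, reflection_inv, ← mul_assoc, reflection_mul_self, one_mul]
        rw [mul_assoc (S.translation 1), ← mul_assoc (S.reflection t), h3]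
        group
    exact ⟨key 1 (one_mem _), key _ (unip_mem _ _ _)⟩

end Decompositions

end Setting

section Reps

variable {G : Type*} [Group G]

/-- A finite index subgroup `M` of `N`, not containing some central element of `N` whose `p`-th
power it contains, has a finite set of coset representatives of cardinality divisible by `p`. -/
lemma exists_reps_of_central {p : ℕ} (hp : p.Prime) {N M : Subgroup G} {α : Type*} [Finite α]
    (f : N → α) (hf : ∀ a b : N, f a = f b → (a : G)⁻¹ * b ∈ M) {z : G} (hzN : z ∈ N)
    (hz : ∀ a ∈ N, z * a = a * z) (hzp : z ^ p ∈ M) (hzM : z ∉ M) :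
    ∃ U : Finset G, (∀ u ∈ U, u ∈ N) ∧ (∀ a ∈ N, ∃! u, u ∈ U ∧ a⁻¹ * u ∈ M) ∧ p ∣ U.card := by
  have : Fact p.Prime := ⟨hp⟩
  have hmk : ∀ a b : N, (QuotientGroup.mk a : N ⧸ M.subgroupOf N) = QuotientGroup.mk b ↔
      (a : G)⁻¹ * b ∈ M := fun a b => by
    rw [QuotientGroup.eq, Subgroup.mem_subgroupOf]
    rfl
  have : Finite (N ⧸ M.subgroupOf N) := by
    refine Finite.of_injective (fun x => f x.out) fun x y hxy => ?_
    have := (hmk _ _).2 (hf _ _ hxy)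
    rwa [QuotientGroup.out_eq', QuotientGroup.out_eq'] at this
  have : Fintype (N ⧸ M.subgroupOf N) := Fintype.ofFinite _
  have hinj : Function.Injective (fun x : N ⧸ M.subgroupOf N => ((x.out : N) : G)) :=
    fun x y hxy => Quotient.out_injective (Subtype.ext hxy)
  refine ⟨Finset.univ.image fun x : N ⧸ M.subgroupOf N => ((x.out : N) : G), ?_, ?_, ?_⟩
  · intro u hu
    obtain ⟨x, -, rfl⟩ := Finset.mem_image.1 hu
    exact x.out.2
  · intro a ha
    refine ⟨((QuotientGroup.mk (⟨a, ha⟩ : N) : N ⧸ M.subgroupOf N).out : N),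
      ⟨Finset.mem_image_of_mem _ (Finset.mem_univ _), ?_⟩, ?_⟩
    · exact (hmk ⟨a, ha⟩ _).1 (QuotientGroup.out_eq' _).symm
    · rintro u ⟨hu, hau⟩
      obtain ⟨x, -, rfl⟩ := Finset.mem_image.1 hu
      have := (hmk ⟨a, ha⟩ x.out).2 hau
      rw [QuotientGroup.out_eq'] at this
      rw [this]
  · rw [Finset.card_image_of_injective _ hinj, Finset.card_univ]
    let e : Function.End (N ⧸ M.subgroupOf N) := fun x => (⟨z, hzN⟩ : N) • x
    have he : ∀ (n : ℕ) (a : N), (e ^ n) (QuotientGroup.mk a) =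
        QuotientGroup.mk ((⟨z, hzN⟩ : N) ^ n * a) := by
      intro n
      induction n with
      | zero =>
        intro a
        rw [pow_zero, pow_zero, one_mul]
        rfl
      | succ n ih =>
        intro a
        rw [pow_succ', pow_succ', mul_assoc]
        exact congrArg e (ih a)
    have hpow : e ^ p ^ 1 = 1 := by
      funext x
      obtain ⟨a, rfl⟩ := QuotientGroup.mk_surjective x
      rw [pow_one, he, Function.End.one_def, id, eq_comm, hmk]
      have hc : Commute z (a : G) := hz a a.2
      have := (hc.pow_left p).eq
      rw [Subgroup.coe_mul, Subgroup.coe_pow, this, inv_mul_cancel_left]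
      exact hzp
    have hfix := Equiv.Perm.card_fixedPoints_modEq hpow
    have hempty : Fintype.card (Function.fixedPoints e) = 0 := by
      rw [Fintype.card_eq_zero_iff]
      refine ⟨fun ⟨x, hx⟩ => ?_⟩
      obtain ⟨a, rfl⟩ := QuotientGroup.mk_surjective x
      have h1 := he 1 a
      rw [pow_one, pow_one, hx.eq, hmk, Subgroup.coe_mul, hz a a.2, inv_mul_cancel_left] at h1
      exact hzM h1
    rw [hempty] at hfix
    exact (Nat.modEq_zero_iff_dvd).1 hfix

/-- Transport of coset representatives along a two-sided translation. -/
lemma isCosetReps_image [DecidableEq G] {K L A B : Subgroup G} {U : Finset G} (hU : ∀ u ∈ U, u ∈ A)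
    (hU' : ∀ a ∈ A, ∃! u, u ∈ U ∧ a⁻¹ * u ∈ B) (c d : G)
    (hmem : ∀ u ∈ A, c * u * d ∈ K ∧ c * u * d ∉ L)
    (hconj : ∀ u ∈ A, d⁻¹ * u * d ∈ K ⊓ L ↔ u ∈ B)
    (hex : ∀ x ∈ K, x ∉ L → ∃ u ∈ A, (c * u * d)⁻¹ * x ∈ K ⊓ L) :
    IsCosetReps K L (U.image fun u => c * u * d) := by
  have key : ∀ u v : G, (c * u * d)⁻¹ * (c * v * d) = d⁻¹ * (u⁻¹ * v) * d := by
    intro u v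
    group
  refine ⟨fun l hl => ?_, fun x hxK hxL => ?_⟩
  · obtain ⟨u, hu, rfl⟩ := Finset.mem_image.1 hl
    exact hmem u (hU u hu)
  · obtain ⟨a, ha, hax⟩ := hex x hxK hxL
    obtain ⟨u, ⟨hu, hau⟩, huniq⟩ := hU' a ha
    refine ⟨c * u * d, ⟨Finset.mem_image_of_mem _ hu, ?_⟩, ?_⟩
    · have h1 := (hconj _ (mul_mem (inv_mem (hU u hu)) ha)).2 (by
        have := inv_mem hau
        rwa [mul_inv_rev, inv_inv] at this)
      have h2 := mul_mem h1 hax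
      rwa [← key, mul_assoc, mul_inv_cancel_left] at h2
    · rintro l ⟨hl, hlx⟩
      obtain ⟨v, hv, rfl⟩ := Finset.mem_image.1 hl
      have h1 := mul_mem hax (inv_mem hlx)
      have h2 : (c * a * d)⁻¹ * x * ((c * v * d)⁻¹ * x)⁻¹ = (c * a * d)⁻¹ * (c * v * d) := by
        group
      rw [h2, key, hconj _ (mul_mem (inv_mem ha) (hU v hv))] at h1
      rw [huniq v ⟨hv, h1⟩]

end Reps

namespace Setting

variable {S : Setting}

section Reps

lemma IsReps.mul {A B C : Subgroup S.GG} (hBA : B ≤ A) (hCB : C ≤ B) {U V : Finset S.GG}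
    (hU : S.IsReps A B U) (hV : S.IsReps B C V) :
    S.IsReps A C ((U ×ˢ V).image fun x => x.1 * x.2) ∧
      Set.InjOn (fun x : S.GG × S.GG => x.1 * x.2) (U ×ˢ V : Finset (S.GG × S.GG)) := by
  have hUA : ∀ u ∈ U, u ∈ A := fun u hu => hU.1 hu
  have hVB : ∀ v ∈ V, v ∈ B := fun v hv => hV.1 hv
  refine ⟨⟨fun x hx => ?_, fun a ha => ?_⟩, fun x hx y hy hxy => ?_⟩
  · obtain ⟨⟨u, v⟩, huv, rfl⟩ := Finset.mem_image.1 (Finset.mem_coe.1 hx)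
    obtain ⟨hu, hv⟩ := Finset.mem_product.1 huv
    exact mul_mem (hUA u hu) (hBA (hVB v hv))
  · obtain ⟨u, ⟨hu, hau⟩, huniq⟩ := hU.2 a ha
    obtain ⟨v, ⟨hv, hbv⟩, hvniq⟩ := hV.2 (u⁻¹ * a) (by
      have := inv_mem (show a⁻¹ * u ∈ B from hau)
      rwa [mul_inv_rev, inv_inv] at this)
    rw [mul_inv_rev, inv_inv, mul_assoc] at hbv
    refine ⟨u * v, ⟨Finset.mem_image.2 ⟨(u, v), Finset.mem_product.2 ⟨hu, hv⟩, rfl⟩, hbv⟩, ?_⟩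
    rintro w ⟨hw, haw⟩
    obtain ⟨⟨u', v'⟩, huv, rfl⟩ := Finset.mem_image.1 hw
    obtain ⟨hu', hv'⟩ := Finset.mem_product.1 huv
    have h1 : a⁻¹ * u' ∈ B := by
      have := mul_mem (hCB haw) (inv_mem (hVB v' hv'))
      rwa [mul_assoc, mul_inv_cancel_right] at this
    obtain rfl := huniq u' ⟨hu', h1⟩
    rw [hvniq v' ⟨hv', by rwa [mul_inv_rev, inv_inv, mul_assoc]⟩]
  · obtain ⟨u, v⟩ := x
    obtain ⟨u', v'⟩ := y
    obtain ⟨hu, hv⟩ := Finset.mem_product.1 (Finset.mem_coe.1 hx)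
    obtain ⟨hu', hv'⟩ := Finset.mem_product.1 (Finset.mem_coe.1 hy)
    replace hxy : u * v = u' * v' := hxy
    have h1 : u⁻¹ * u' ∈ B := by
      have h2 : u⁻¹ * u' = v * v'⁻¹ := by
        rw [inv_mul_eq_iff_eq_mul, ← mul_assoc, hxy, mul_inv_cancel_right]
      rw [h2]
      exact mul_mem (hVB v hv) (inv_mem (hVB v' hv'))
    obtain rfl : u = u' := (hU.2 u (hUA u hu)).unique
      ⟨hu, by rw [inv_mul_cancel]; exact one_mem B⟩ ⟨hu', h1⟩
    rw [mul_left_cancel hxy]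

lemma coe_unipotent_inf (k : ℤ) :
    ((S.unipotent ⊓ S.vertexGroup (-k) : Subgroup S.GG) : Set S.GG) = S.Nk k := by
  ext g
  exact mem_Nk_iff.symm

lemma unipotent_inf_mono {s t : ℤ} (h : s ≤ t) :
    S.unipotent ⊓ S.vertexGroup s ≤ S.unipotent ⊓ S.vertexGroup t := by
  rintro g ⟨⟨x, y, hxy, hg⟩, hgs⟩
  obtain rfl : g = unip x y hxy := mat_injective hg
  refine ⟨unip_mem _ _ _, unip_mem_vertexGroup.2 (pE_mono (by omega) (unip_mem_vertexGroup.1 hgs))⟩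

variable (S) in
/-- The residue of an integral element, extended by zero. -/
def residue (x : S.E) : S.kE := if h : x ∈ S.O then Ideal.Quotient.mk S.mI ⟨x, h⟩ else 0

lemma sub_mem_of_residue_eq {x y : S.E} (hx : x ∈ S.O) (hy : y ∈ S.O)
    (h : S.residue x = S.residue y) : x - y ∈ S.pE 1 := by
  rw [residue, residue, dif_pos hx, dif_pos hy, Ideal.Quotient.eq, mem_mI_iff] at h
  exact h

lemma unip_zero_pow (y : S.E) (h) (n : ℕ) :
    ∃ h', (unip 0 y h) ^ n = unip (S := S) 0 (n * y) h' := by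
  induction n with
  | zero =>
    refine ⟨by simp, mat_injective ?_⟩
    rw [pow_zero, mat_one, mat_unip]
    ext i j
    fin_cases i <;> fin_cases j <;> simp [nM]
  | succ n ih =>
    obtain ⟨h1, h2⟩ := ih
    have h3 : (0 : S.E) * S.conj 0 + ((n + 1 : ℕ) : S.E) * y +
        S.conj (((n + 1 : ℕ) : S.E) * y) = 0 := by
      push_cast
      simp only [map_mul, map_add, map_natCast, map_one, zero_mul, zero_add] at h1 h ⊢
      linear_combination h1 + h
    refine ⟨h3, mat_injective ?_⟩
    rw [pow_succ, h2, unip_mul, mat_unip, mat_unip]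
    ext i j
    fin_cases i <;> fin_cases j <;> simp [nM]
    ring

/-- Successive quotients of the filtration of `N` are finite, of order divisible by `p`. -/
lemma exists_unipotent_reps (t : ℤ) : ∃ U : Finset S.GG,
    S.IsReps (S.unipotent ⊓ S.vertexGroup t : Subgroup S.GG)
      (S.unipotent ⊓ S.vertexGroup (t - 1) : Subgroup S.GG) U ∧ S.p ∣ U.card := by
  obtain ⟨y, h, hy, hy'⟩ := exists_central_unip (S := S) t
  have hf : ∀ a b : ↥(S.unipotent ⊓ S.vertexGroup t),
      (S.residue (S.ϖ ^ (-((-t + 1) / 2)) * S.mat a 0 1), S.residue (S.ϖ ^ t * S.mat a 0 2)) =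
      (S.residue (S.ϖ ^ (-((-t + 1) / 2)) * S.mat b 0 1), S.residue (S.ϖ ^ t * S.mat b 0 2)) →
      (a : S.GG)⁻¹ * b ∈ S.unipotent ⊓ S.vertexGroup (t - 1) := by
    rintro ⟨a, ⟨x, y, hxy, ha⟩, hat⟩ ⟨b, ⟨x', y', hxy', hb⟩, hbt⟩ hab
    obtain rfl : a = unip x y hxy := mat_injective ha
    obtain rfl : b = unip x' y' hxy' := mat_injective hb
    have hx : x ∈ S.pE ((-t + 1) / 2) := by
      simpa [mat_unip, nM] using (mem_levelSet_iff.1 hat).2.1.1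
    have hx' : x' ∈ S.pE ((-t + 1) / 2) := by
      simpa [mat_unip, nM] using (mem_levelSet_iff.1 hbt).2.1.1
    have hyt := unip_mem_vertexGroup.1 hat
    have hyt' := unip_mem_vertexGroup.1 hbt
    obtain ⟨h1, h2⟩ := Prod.mk.inj hab
    simp only [mat_unip, nM] at h1 h2
    have h3 := sub_mem_of_residue_eq ((mem_pE_iff S).1 hx) ((mem_pE_iff S).1 hx') h1
    have hy1 := (mem_pE_iff S).1 hyt
    have hy2 := (mem_pE_iff S).1 hyt'
    rw [neg_neg] at hy1 hy2
    have h4 := sub_mem_of_residue_eq hy1 hy2 h2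
    rw [← mul_sub, unif_zpow_mul_mem_pE] at h3 h4
    refine Subgroup.mem_inf.2 ⟨mul_mem (inv_mem (unip_mem _ _ hxy)) (unip_mem _ _ hxy'), ?_⟩
    show (unip x y hxy)⁻¹ * unip x' y' hxy' ∈ _
    rw [unip_inv, unip_mul, unip_mem_vertexGroup]
    have h5 : S.conj y + y' - -x * S.conj x' = -(y - y') + -(x * S.conj (x - x')) := by
      rw [map_sub]
      linear_combination hxy
    rw [h5]
    refine add_mem_pE (neg_mem_pE (pE_mono (by omega) h4)) (neg_mem_pE ?_)
    exact pE_mono (by omega) (mul_mem_pE hx (conj_mem_pE h3))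
  obtain ⟨U, h1, h2, h3⟩ := exists_reps_of_central S.hp (α := S.kE × S.kE) _ hf
    (z := unip 0 y h) ⟨unip_mem _ _ _, hy⟩ (by
      rintro a ⟨⟨x', y', h', ha⟩, -⟩
      obtain rfl : a = unip x' y' h' := mat_injective ha
      rw [unip_mul, unip_mul]
      apply mat_injective
      rw [mat_unip, mat_unip]
      ext i j
      fin_cases i <;> fin_cases j <;> simp [nM]
      ring) (by
      obtain ⟨h', hz⟩ := unip_zero_pow y h S.p
      rw [hz]
      refine ⟨unip_mem _ _ _, unip_mem_vertexGroup.2 ?_⟩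
      exact pE_mono (by omega) (mul_mem_pE natCast_p_mem (unip_mem_vertexGroup.1 hy)))
    (fun hz => hy' hz.2)
  exact ⟨U, ⟨fun u hu => h1 u hu, h2⟩, h3⟩

lemma unip_mul_reflection_mem {t : ℤ} {u : S.GG} (hu : u ∈ S.unipotent ⊓ S.vertexGroup t) :
    u * S.reflection t ∈ S.vertexGroup t ∧ u * S.reflection t ∉ S.vertexGroup (t + 1) := by
  refine ⟨mul_mem hu.2 (reflection_mem t), fun h => ?_⟩
  have h0 : u ∈ S.vertexGroup (t + 1) :=
    (Subgroup.mem_inf.1 (unipotent_inf_mono (show t ≤ t + 1 by omega) hu)).2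
  have h1 := mul_mem (inv_mem h0) h
  rw [inv_mul_cancel_left] at h1
  have h2 := (mem_levelSet_iff.1 h1).2.2.2.2
  simp only [reflection, mat_ofMat] at h2
  have h3 : S.ϖ ^ t ∈ S.pE (t + 1) := pE_mono (by omega) h2
  rw [unif_zpow_mem_pE_iff] at h3
  omega

lemma isCosetReps_vertexGroup {t : ℤ} {U : Finset S.GG}
    (hU : S.IsReps (S.unipotent ⊓ S.vertexGroup t : Subgroup S.GG)
      (S.unipotent ⊓ S.vertexGroup (t - 1) : Subgroup S.GG) U) :
    IsCosetReps (S.vertexGroup t) (S.vertexGroup (t + 1))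
      (U.image fun u => 1 * u * S.reflection t) := by
  refine isCosetReps_image (fun u hu => hU.1 hu) hU.2 _ _ (fun u hu => ?_) (fun u hu => ?_)
    (fun x hx hx' => ?_)
  · rw [one_mul]
    exact unip_mul_reflection_mem hu
  · rw [reflection_inv, Subgroup.mem_inf, Subgroup.mem_inf, show t + 1 = 2 * t - (t - 1) by ring,
      reflection_conj_mem_iff]
    have h1 : S.reflection t * u * S.reflection t ∈ S.vertexGroup t :=
      mul_mem (mul_mem (reflection_mem t) hu.2) (reflection_mem t)
    have h2 : u ∈ S.unipotent := hu.1
    tauto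
  · obtain ⟨u, hu, hut, h⟩ := exists_bruhat hx hx'
    exact ⟨u, ⟨hu, hut⟩, by rwa [one_mul]⟩

lemma isCosetReps_vertexGroup_succ {t : ℤ} {U : Finset S.GG}
    (hU : S.IsReps (S.unipotent ⊓ S.vertexGroup (t - 1) : Subgroup S.GG)
      (S.unipotent ⊓ S.vertexGroup (t - 2) : Subgroup S.GG) U) :
    IsCosetReps (S.vertexGroup (t + 1)) (S.vertexGroup t)
      (U.image fun u => S.reflection t * u * (S.translation 1)⁻¹) := by
  refine isCosetReps_image (fun u hu => hU.1 hu) hU.2 _ _ (fun u hu => ?_) (fun u hu => ?_)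
    (fun x hx hx' => ?_)
  · have h1 : S.reflection t * u * (S.translation 1)⁻¹ =
        S.reflection t * (u * S.reflection (t - 1)) * S.reflection t := by
      have : (S.translation 1)⁻¹ = S.reflection (t - 1) * S.reflection t := by
        rw [reflection_mul_reflection, translation_inv]
        congr 1
        ring
      rw [this]
      simp only [mul_assoc]
    rw [h1]
    obtain ⟨h2, h3⟩ := unip_mul_reflection_mem hu
    rw [← reflection_conj_mem_iff (t := t)] at h2 h3
    rw [show 2 * t - (t - 1) = t + 1 by ring] at h2
    rw [show 2 * t - (t - 1 + 1) = t by ring] at h3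
    exact ⟨h2, h3⟩
  · have hconj : ∀ s, (S.translation 1)⁻¹⁻¹ * u * (S.translation 1)⁻¹ ∈ S.vertexGroup (s + 2) ↔
        u ∈ S.vertexGroup s := by
      intro s
      have := translation_conj_mem_iff (S := S) (t := -1) (s := s) (g := u)
      rwa [← translation_inv, show s - 2 * -1 = s + 2 by ring] at this
    rw [Subgroup.mem_inf, Subgroup.mem_inf, show t + 1 = (t - 1) + 2 by ring, hconj,
      show S.vertexGroup t = S.vertexGroup ((t - 2) + 2) by congr 1; ring, hconj]
    have h1 : u ∈ S.unipotent := hu.1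
    have h2 : u ∈ S.vertexGroup (t - 1) := hu.2
    tauto
  · obtain ⟨u, hu, hut, h⟩ := exists_bruhat_succ hx hx'
    exact ⟨u, ⟨hu, hut⟩, by rwa [inf_comm]⟩

end Reps

end Setting

namespace Chamber

variable {S : Setting} {C : Chamber S}

open Setting

lemma K_eq : C.K = S.vertexGroup (-C.nK) := by
  apply SetLike.coe_injective
  rcases C.cases with ⟨hK, -, -, -, -, -, hn, -⟩ | ⟨hK, -, -, -, -, -, hn, -⟩
  · rw [hK, hn]
    ext g
    rw [SetLike.mem_coe, mem_vertexGroup, mem_levelSet_iff]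
    norm_num [K0set, Fin.forall_fin_succ, mem_pE_zero]
    tauto
  · rw [hK, hn]
    ext g
    rw [SetLike.mem_coe, mem_vertexGroup, mem_levelSet_iff]
    norm_num [K1set, mem_pE_zero]
    tauto

lemma mem_K {g : S.GG} : g ∈ C.K ↔ g ∈ S.vertexGroup (-C.nK) := by rw [K_eq]

lemma mem_KoneS {g : S.GG} : g ∈ C.KoneS ↔ S.mat g - 1 ∈ levelSet (-C.nK) 1 := by
  have h1 : ∀ x : S.E, x ∈ S.O ↔ x - 1 ∈ S.O := fun x =>
    ⟨fun h => sub_mem h S.O.one_mem, fun h => by simpa using add_mem h S.O.one_mem⟩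
  have h2 : ∀ x ∈ S.pE 1, x ∈ S.O := fun x hx => mem_pE_zero.1 (pE_mono (by norm_num) hx)
  have h3 : ∀ x ∈ S.pE 2, x ∈ S.pE 1 := fun x hx => pE_mono (by norm_num) hx
  have h4 : ∀ x ∈ S.O, x ∈ S.pE (-1) := fun x hx =>
    pE_mono (by norm_num) (mem_pE_zero.2 hx)
  rcases C.cases with ⟨-, hK, -, -, -, -, hn, -⟩ | ⟨-, hK, -, -, -, -, hn, -⟩
  · rw [hK, hn]
    norm_num [Kone0, levelSet]
  · have e1 : (1 : S.M3) 0 2 = 0 ∧ (1 : S.M3) 1 2 = 0 := by simp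
    have e2 : (1 : S.M3) 2 0 = 0 ∧ (1 : S.M3) 2 1 = 0 := by simp
    rw [hK, hn, mem_levelSet_iff]
    norm_num [Kone1, K1set, mem_pE_zero, e1, e2]
    grind

lemma mem_IK {g : S.GG} :
    g ∈ C.IK ↔ g ∈ S.vertexGroup (-C.nK) ⊓ S.vertexGroup (-C.nK + 1) := by
  have h3 : ∀ x ∈ S.pE 2, x ∈ S.pE 1 := fun x hx => pE_mono (by norm_num) hx
  have h4 : ∀ x ∈ S.O, x ∈ S.pE (-1) := fun x hx =>
    pE_mono (by norm_num) (mem_pE_zero.2 hx)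
  have h5 : ∀ x ∈ S.pE (-1), x ∈ S.pE (-2) := fun x hx => pE_mono (by norm_num) hx
  rcases C.cases with ⟨-, -, hK, -, -, -, hn, -⟩ | ⟨-, -, hK, -, -, -, hn, -⟩
  · rw [hK, hn, Subgroup.mem_inf, mem_vertexGroup, mem_vertexGroup, mem_levelSet_iff,
      mem_levelSet_iff]
    norm_num [IK0, K0set, Fin.forall_fin_succ, mem_pE_zero]
    grind
  · rw [hK, hn, Subgroup.mem_inf, mem_vertexGroup, mem_vertexGroup, mem_levelSet_iff,
      mem_levelSet_iff]
    norm_num [IK1, K1set, mem_pE_zero]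
    grind

lemma mem_I1 {g : S.GG} : g ∈ C.I1 ↔ g ∈ C.IK ∧ ∀ i, S.mat g i i - 1 ∈ S.pE 1 := by
  rcases C.cases with ⟨-, -, hI, hK, -⟩ | ⟨-, -, hI, hK, -⟩ <;>
    rw [hI, hK] <;> simp [I1K0, I1K1, Fin.forall_fin_succ] <;> tauto

lemma mem_I1' {g : S.GG} : g ∈ C.I1' ↔
    g ∈ S.vertexGroup (-C.nK) ⊓ S.vertexGroup (-C.nK - 1) ∧ ∀ i, S.mat g i i - 1 ∈ S.pE 1 := by
  have h2 : ∀ x ∈ S.pE 1, x ∈ S.O := fun x hx => mem_pE_zero.1 (pE_mono (by norm_num) hx)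
  have h4 : ∀ x ∈ S.O, x ∈ S.pE (-1) := fun x hx =>
    pE_mono (by norm_num) (mem_pE_zero.2 hx)
  rcases C.cases with ⟨-, -, -, -, hK, -, hn, -⟩ | ⟨-, -, -, -, hK, -, hn, -⟩
  · rw [hK, hn, Subgroup.mem_inf, mem_vertexGroup, mem_vertexGroup, mem_levelSet_iff,
      mem_levelSet_iff]
    norm_num [I1'K0, K0set, Fin.forall_fin_succ, mem_pE_zero]
    grind
  · rw [hK, hn, Subgroup.mem_inf, mem_vertexGroup, mem_vertexGroup, mem_levelSet_iff,
      mem_levelSet_iff]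
    norm_num [I1'K1, K1set, Fin.forall_fin_succ, mem_pE_zero]
    grind

lemma βK_eq : C.βK = S.reflection (-C.nK) := by
  rcases C.cases with ⟨-, -, -, -, -, hβ, hn, -⟩ | ⟨-, -, -, -, -, hβ, hn, -⟩
  · rw [hβ, hn, betaE_eq, neg_zero]
  · rw [hβ, hn, betaPr_eq, neg_neg]

lemma mem_K_of_mem_IK {g : S.GG} (hg : g ∈ C.IK) : g ∈ C.K := mem_K.2 (mem_IK.1 hg).1

lemma mul_mem_IK {g h : S.GG} (hg : g ∈ C.IK) (hh : h ∈ C.IK) : g * h ∈ C.IK :=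
  mem_IK.2 (mul_mem (mem_IK.1 hg) (mem_IK.1 hh))

lemma inv_mem_IK {g : S.GG} (hg : g ∈ C.IK) : g⁻¹ ∈ C.IK := mem_IK.2 (inv_mem (mem_IK.1 hg))

lemma mul_mem_IK_cancel_left {g h : S.GG} (hg : g ∈ C.IK) : g * h ∈ C.IK ↔ h ∈ C.IK :=
  ⟨fun hh => by simpa using mul_mem_IK (inv_mem_IK hg) hh, mul_mem_IK hg⟩

lemma mul_mem_IK_cancel_right {g h : S.GG} (hg : g ∈ C.IK) : h * g ∈ C.IK ↔ h ∈ C.IK :=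
  ⟨fun hh => by simpa using mul_mem_IK hh (inv_mem_IK hg), fun hh => mul_mem_IK hh hg⟩

lemma mem_IK_of_mem_KoneS {z : S.GG} (hz : z ∈ C.KoneS) : z ∈ C.IK := by
  have h1 := mem_KoneS.1 hz
  have h2 : z ∈ S.vertexGroup (-C.nK) := by
    have := levelSet_add (levelSet_mono (show (0 : ℤ) ≤ 1 by norm_num) h1)
      (one_mem_levelSet (-C.nK))
    rwa [sub_add_cancel] at this
  refine mem_IK.2 ⟨h2, mem_vertexGroup_succ h2 ?_⟩
  have h3 := (mem_levelSet_iff.1 h1).2.2.2.2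
  rw [Matrix.sub_apply, Matrix.one_apply_ne (by decide), sub_zero] at h3
  exact pE_mono (by omega) h3

lemma conj_mem_KoneS {g z : S.GG} (hg : g ∈ C.K) (hz : z ∈ C.KoneS) :
    g⁻¹ * z * g ∈ C.KoneS := by
  rw [mem_KoneS] at hz ⊢
  have h1 := levelSet_mul (levelSet_mul (mem_K.1 (inv_mem hg)) hz) (mem_K.1 hg)
  have h2 : S.mat (g⁻¹ * z * g) - 1 = S.mat g⁻¹ * (S.mat z - 1) * S.mat g := by
    rw [mul_sub, sub_mul, mul_one, ← mat_mul, ← mat_mul, ← mat_mul, inv_mul_cancel, mat_one]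
  rw [h2]
  simpa using h1

lemma diag_sub_one_of_unipotent {u : S.GG} (hu : u ∈ S.unipotent) (i : Fin 3) :
    S.mat u i i - 1 = 0 := by
  obtain ⟨x, y, -, h⟩ := hu
  rw [h]
  fin_cases i <;> simp [nM]

lemma diag_sub_one_of_reflection_conj {t : ℤ} {u : S.GG} (hu : u ∈ S.unipotent) (i : Fin 3) :
    S.mat (S.reflection t * u * S.reflection t) i i - 1 = 0 := by
  rw [mat_mul_reflection, mat_reflection_mul, ← mul_assoc, ← zpow_add₀ S.unif_ne,
    show t * (1 - ((i : ℕ) : ℤ)) + t * (((i : ℕ) : ℤ) - 1) = 0 by ring, zpow_zero, one_mul]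
  exact diag_sub_one_of_unipotent hu i.rev

lemma mem_I1_of_unipotent {u : S.GG} (hu : u ∈ S.unipotent ⊓ S.vertexGroup (-C.nK)) :
    u ∈ C.I1 := by
  have h1 := unipotent_inf_mono (show -C.nK ≤ -C.nK + 1 by omega) hu
  refine mem_I1.2 ⟨mem_IK.2 ⟨hu.2, h1.2⟩, fun i => ?_⟩
  rw [diag_sub_one_of_unipotent hu.1]
  exact zero_mem_pE S 1

lemma reflection_conj_mem_I1' {u : S.GG} (hu : u ∈ S.unipotent ⊓ S.vertexGroup (-C.nK)) :
    C.βK * u * C.βK ∈ C.I1' := by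
  have h1 : u ∈ S.vertexGroup (-C.nK + 1) :=
    (Subgroup.mem_inf.1 (unipotent_inf_mono (show -C.nK ≤ -C.nK + 1 by omega) hu)).2
  have h2 : u ∈ S.vertexGroup (-C.nK) := hu.2
  rw [βK_eq]
  refine mem_I1'.2 ⟨⟨mul_mem (mul_mem (reflection_mem _) h2) (reflection_mem _), ?_⟩,
    fun i => ?_⟩
  · have := (reflection_conj_mem_iff (t := -C.nK)).2 h1
    rwa [show 2 * -C.nK - (-C.nK + 1) = -C.nK - 1 by ring] at this
  · rw [diag_sub_one_of_reflection_conj hu.1]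
    exact zero_mem_pE S 1

lemma reflection_conj_mem_I1 {u : S.GG} (hu : u ∈ S.unipotent ⊓ S.vertexGroup (-C.nK - 1)) :
    C.βK * u * C.βK ∈ C.I1 := by
  have h1 : u ∈ S.vertexGroup (-C.nK) :=
    (Subgroup.mem_inf.1 (unipotent_inf_mono (show -C.nK - 1 ≤ -C.nK by omega) hu)).2
  have h2 : u ∈ S.vertexGroup (-C.nK - 1) := hu.2
  rw [βK_eq]
  refine mem_I1.2 ⟨mem_IK.2 ⟨mul_mem (mul_mem (reflection_mem _) h1) (reflection_mem _), ?_⟩,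
    fun i => ?_⟩
  · have := (reflection_conj_mem_iff (t := -C.nK)).2 h2
    rwa [show 2 * -C.nK - (-C.nK - 1) = -C.nK + 1 by ring] at this
  · rw [diag_sub_one_of_reflection_conj hu.1]
    exact zero_mem_pE S 1

lemma βK_mem : C.βK ∈ C.K := by
  rw [mem_K, βK_eq]
  exact reflection_mem _

lemma βK_mul_self : C.βK * C.βK = 1 := by
  rw [βK_eq, reflection_mul_self]

lemma exists_eq_mul_βK_mul {x : S.GG} (hx : x ∈ C.K) (hx' : x ∉ C.IK) :
    ∃ i ∈ C.IK, ∃ b ∈ C.I1, x = i * C.βK * b := by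
  have h1 : x⁻¹ ∉ S.vertexGroup (-C.nK + 1) := fun h =>
    hx' (mem_IK.2 ⟨mem_K.1 hx, by simpa using inv_mem h⟩)
  obtain ⟨u, hu, hut, h⟩ := exists_bruhat (mem_K.1 (inv_mem hx)) h1
  refine ⟨_, mem_IK.2 (inv_mem h), u⁻¹, mem_I1_of_unipotent (inv_mem ⟨hu, hut⟩), ?_⟩
  have h2 := reflection_mul_self (S := S) (-C.nK)
  rw [βK_eq, mul_inv_rev, inv_inv, inv_inv]
  simp only [mul_assoc]
  rw [← mul_assoc (S.reflection _), h2, one_mul, mul_inv_cancel, mul_one]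

lemma exists_H0_mul {g : S.GG} (hg : g ∈ C.IK) : ∃ h ∈ C.H0, h⁻¹ * g ∈ C.I1 := by
  obtain ⟨h1, h2⟩ := mem_IK.1 hg
  obtain ⟨⟨h00, h11, h22⟩, ⟨h01, h12⟩, h02, ⟨h10, h21⟩, h20⟩ := mem_levelSet_iff.1 h1
  obtain ⟨-, ⟨k01, k12⟩, k02, ⟨k10, k21⟩, k20⟩ := mem_levelSet_iff.1 h2
  have e1 : S.mat g 0 0 * S.conj (S.mat g 2 2) - 1 ∈ S.pE 1 := by
    have e := mat_form g 0 2
    rw [show S.betaM 0 2 = 1 by simp [betaM]] at e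
    have e' : S.mat g 0 0 * S.conj (S.mat g 2 2) - 1 = -(S.mat g 1 0 * S.conj (S.mat g 1 2)) -
        S.mat g 2 0 * S.conj (S.mat g 0 2) := by linear_combination e
    rw [e']
    exact sub_mem_pE (neg_mem_pE (pE_mono (by omega) (mul_mem_pE k10 (conj_mem_pE h12))))
      (pE_mono (by omega) (mul_mem_pE k20 (conj_mem_pE h02)))
  have e2 : S.mat g 1 1 * S.conj (S.mat g 1 1) - 1 ∈ S.pE 1 := by
    have e := mat_form g 1 1
    rw [show S.betaM 1 1 = 1 by simp [betaM]] at e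
    have e' : S.mat g 1 1 * S.conj (S.mat g 1 1) - 1 = -(S.mat g 0 1 * S.conj (S.mat g 2 1)) -
        S.mat g 2 1 * S.conj (S.mat g 0 1) := by linear_combination e
    rw [e']
    exact sub_mem_pE (neg_mem_pE (pE_mono (by omega) (mul_mem_pE h01 (conj_mem_pE k21))))
      (pE_mono (by omega) (mul_mem_pE k21 (conj_mem_pE h01)))
  norm_num [mem_pE_zero] at h00 h11 h22
  obtain ⟨b, hb, hb1, hgb⟩ := exists_norm_one h11 e2
  set a := S.mat g 0 0 with ha
  have ha1 : a ∉ S.pE 1 := by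
    intro h
    have h3 := sub_mem_pE (mul_mem_pE h (conj_mem_pE (mem_pE_zero.2 h22))) (by simpa using e1)
    rw [sub_sub_cancel, ← zpow_zero S.ϖ, unif_zpow_mem_pE_iff] at h3
    omega
  have ha0 : a ≠ 0 := fun h => ha1 (by rw [h]; exact zero_mem_pE S 1)
  have ha' : a⁻¹ ∈ S.O :=
    inv_mem_of_val_eq_zero ha0 ((val_eq_iff ha0).2 ⟨mem_pE_zero.2 h00, by simpa using ha1⟩)
  have hca0 : S.conj a ≠ 0 := conj_ne_zero ha0
  let h : S.GG := ofMat !![a, 0, 0; 0, b, 0; 0, 0, (S.conj a)⁻¹] (by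
    ext i j
    rw [transpose_mul_betaM_mul_apply]
    fin_cases i <;> fin_cases j <;> simp [betaM, hb1, ha0, hca0, S.conj_invol])
  have hh : ∀ t, h ∈ S.vertexGroup t := fun t => by
    have := S.conj_O _ ha'
    rw [map_inv₀] at this
    have hz := zero_mem_pE S
    exact mem_levelSet_iff.2 ⟨⟨mem_pE_zero.2 h00, mem_pE_zero.2 hb, mem_pE_zero.2 this⟩,
      ⟨hz _, hz _⟩, hz _, ⟨hz _, hz _⟩, hz _⟩
  refine ⟨h, ⟨⟨a, b, _, rfl⟩, mem_IK.2 ⟨hh _, hh _⟩⟩,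
    mem_I1.2 ⟨mul_mem_IK (inv_mem_IK (mem_IK.2 ⟨hh _, hh _⟩)) hg, fun i => ?_⟩⟩
  have hd : ∀ i, S.mat (h⁻¹ * g) i i = S.conj (S.mat h i.rev i.rev) * S.mat g i i := by
    intro i
    rw [mat_mul_apply, mat_inv_apply, mat_inv_apply, mat_inv_apply]
    fin_cases i <;> simp [h, mat_ofMat]
  rw [hd]
  fin_cases i
  · have : S.conj (S.conj a)⁻¹ * a - 1 = 0 := by
      rw [map_inv₀, S.conj_invol a, inv_mul_cancel₀ ha0, sub_self]
    exact (congrArg (· ∈ S.pE 1) this).mpr (zero_mem_pE S 1)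
  · have h3 := mul_mem_pE (mem_pE_zero.2 (S.conj_O _ hb)) hgb
    rw [mul_sub, mul_comm _ b, hb1] at h3
    simpa [h, mat_ofMat] using h3
  · have h3 := conj_mem_pE e1
    rw [map_sub, map_mul, S.conj_invol, map_one] at h3
    simpa [h, mat_ofMat] using h3

end Chamber

section Steinberg

open Setting Chamber

variable {S : Setting} {C : Chamber S} {𝔽 : Type} [Field 𝔽] {W : Type} [AddCommGroup W]
  [Module 𝔽 W] {σ : Representation 𝔽 ↥C.K W}

lemma sigma'_apply {g : S.GG} (hg : g ∈ C.K) : sigma' C 𝔽 W σ g = σ ⟨g, hg⟩ := dif_pos hg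

lemma sigma'_mul_apply {g h : S.GG} (hg : g ∈ C.K) (hh : h ∈ C.K) (v : W) :
    sigma' C 𝔽 W σ (g * h) v = sigma' C 𝔽 W σ g (sigma' C 𝔽 W σ h v) := by
  rw [sigma'_apply hg, sigma'_apply hh, sigma'_apply (mul_mem hg hh), ← Module.End.mul_apply,
    ← map_mul]
  rfl

lemma stdFn_apply_of_mem {g x : S.GG} (h : x * g ∈ C.K) (v : W) :
    stdFn C 𝔽 W σ g v x = sigma' C 𝔽 W σ (x * g) v := by
  rw [stdFn, dif_pos h, sigma'_apply h]

lemma stdFn_apply_of_notMem {g x : S.GG} (h : x * g ∉ C.K) (v : W) :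
    stdFn C 𝔽 W σ g v x = 0 := dif_neg h

variable (C 𝔽) in
/-- The right translate by `g` of the indicator function of the Iwahori subgroup, restricted
to `K`. -/
def iwahoriIndicator (g : S.GG) : ↥(PS1sub C 𝔽) :=
  ⟨fun x => if (x : S.GG) * g ∈ C.IK then 1 else 0, by
    have key : ∀ b ∈ C.IK, ∀ x : S.GG, b * x * g ∈ C.IK ↔ x * g ∈ C.IK := fun b hb x => by
      rw [mul_assoc, mul_mem_IK_cancel_left hb]
    refine ⟨fun b hb x => ?_, fun h hh x => ?_, fun z hz x => ?_⟩
    · simp only [Subgroup.coe_mul, key _ (mem_I1.1 hb).1]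
    · simp only [Subgroup.coe_mul, key _ hh.2, one_mul]
    · by_cases hg : g ∈ C.K
      · have h1 := mem_IK_of_mem_KoneS (conj_mem_KoneS hg hz)
        have h2 : (x : S.GG) * z * g = x * g * (g⁻¹ * z * g) := by group
        simp only [Subgroup.coe_mul, h2, mul_mem_IK_cancel_right h1]
      · have h3 : ∀ y : ↥C.K, (y : S.GG) * g ∉ C.IK := fun y hy =>
          hg ((Subgroup.mul_mem_cancel_left _ y.2).1 (mem_K_of_mem_IK hy))
        exact (if_neg (h3 _)).trans (if_neg (h3 _)).symm⟩

lemma iwahoriIndicator_eq_zero {g : S.GG} (hg : g ∉ C.K) : iwahoriIndicator C 𝔽 g = 0 :=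
  Subtype.ext <| funext fun y => if_neg fun hy =>
    hg ((Subgroup.mul_mem_cancel_left _ y.2).1 (mem_K_of_mem_IK hy))

lemma linearCombination_iwahoriIndicator (c : S.GG →₀ 𝔽) (x : ↥C.K) :
    (Finsupp.linearCombination 𝔽 (iwahoriIndicator C 𝔽) c : ↥C.K → 𝔽) x =
      cosetSum 𝔽 C.IK (x : S.GG)⁻¹ c := by
  induction c using Finsupp.induction_linear with
  | zero => simp
  | add f g hf hg => rw [map_add, map_add, ← hf, ← hg]; rfl
  | single g a =>
    rw [Finsupp.linearCombination_single, cosetSum_single, inv_inv]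
    show a * (if _ then _ else _) = _
    rw [mul_ite, mul_one, mul_zero]

/-- A function in the principal series of the trivial character is left invariant under the Iwahori
subgroup. -/
lemma apply_mul_of_mem_PS1sub (f : ↥(PS1sub C 𝔽)) {b : ↥C.K} (hb : (b : S.GG) ∈ C.IK) (x : ↥C.K) :
    (f : ↥C.K → 𝔽) (b * x) = (f : ↥C.K → 𝔽) x := by
  obtain ⟨h, hh, hb'⟩ := exists_H0_mul hb
  have hhK : h ∈ C.K := mem_K_of_mem_IK hh.2
  have h1 := f.2.1 ⟨h⁻¹ * b, mul_mem (inv_mem hhK) b.2⟩ hb' x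
  have h2 := f.2.2.1 ⟨h, hhK⟩ hh (⟨h⁻¹ * b, mul_mem (inv_mem hhK) b.2⟩ * x)
  rw [one_mul, h1] at h2
  have h3 : b * x = ⟨h, hhK⟩ * (⟨h⁻¹ * b, mul_mem (inv_mem hhK) b.2⟩ * x) :=
    Subtype.ext (by simp only [Subgroup.coe_mul]; group)
  rw [h3, h2]

/-- A function in the principal series of the trivial character is determined by its values at
`1` and at `β_K` as soon as it is right invariant under the pro-`p` Iwahori subgroup. -/
lemma eq_add_smul_iwahoriIndicator (f : ↥(PS1sub C 𝔽))
    (hf : ∀ x b : ↥C.K, (b : S.GG) ∈ C.I1 → (f : ↥C.K → 𝔽) (x * b) = (f : ↥C.K → 𝔽) x) :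
    ∃ a e : 𝔽, (f : ↥C.K → 𝔽) =
      fun x => a * (iwahoriIndicator C 𝔽 1 : ↥C.K → 𝔽) x + e := by
  refine ⟨(f : ↥C.K → 𝔽) 1 - (f : ↥C.K → 𝔽) ⟨C.βK, βK_mem⟩, (f : ↥C.K → 𝔽) ⟨C.βK, βK_mem⟩,
    funext fun x => ?_⟩
  by_cases hx : (x : S.GG) ∈ C.IK
  · have h1 := apply_mul_of_mem_PS1sub f hx 1
    have h2 : (iwahoriIndicator C 𝔽 1 : ↥C.K → 𝔽) x = 1 := if_pos (by rwa [mul_one])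
    rw [h2, mul_one, sub_add_cancel, ← h1, mul_one]
  · have h2 : (iwahoriIndicator C 𝔽 1 : ↥C.K → 𝔽) x = 0 := if_neg (by rwa [mul_one])
    obtain ⟨i, hi, b, hb, hxib⟩ := exists_eq_mul_βK_mul x.2 hx
    have hiK := mem_K_of_mem_IK hi
    have hbK := mem_K_of_mem_IK (mem_I1.1 hb).1
    have h3 : x = ⟨i, hiK⟩ * ⟨C.βK, βK_mem⟩ * ⟨b, hbK⟩ := Subtype.ext hxib
    rw [h2, mul_zero, zero_add, h3, hf _ _ hb, apply_mul_of_mem_PS1sub f hi]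

/-- The linear relations between the translates of a nonzero vector of the Steinberg weight fixed
by the pro-`p` Iwahori subgroup. -/
lemma linearCombination_stdFn_eq_zero_iff (hst : IsSteinberg C 𝔽 σ) {v : W} (hv0 : v ≠ 0)
    (hv : ∀ g ∈ C.I1, sigma' C 𝔽 W σ g v = v) (c : S.GG →₀ 𝔽) :
    Finsupp.linearCombination 𝔽 (stdFn C 𝔽 W σ 1 v) c = 0 ↔
      ∀ k ∈ C.K, cosetSum 𝔽 C.IK k c = cosetSum 𝔽 C.IK 1 c := by
  obtain ⟨φ, hφ, hker, hequiv⟩ := hst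
  obtain ⟨a, ha, hva⟩ : ∃ a : 𝔽, a ≠ 0 ∧ v = a • φ (iwahoriIndicator C 𝔽 1) := by
    obtain ⟨f, hf⟩ := hφ v
    have hf1 : ∀ x b : ↥C.K, (b : S.GG) ∈ C.I1 →
        (f : ↥C.K → 𝔽) (x * b) = (f : ↥C.K → 𝔽) x := by
      intro x b hb
      have hmem : PSact C 𝔽 b f ∈ PS1sub C 𝔽 := by
        refine ⟨fun i hi y => ?_, fun h hh y => ?_, fun z hz y => ?_⟩
        · simp only [PSact, mul_assoc]
          exact f.2.1 i hi _
        · simp only [PSact, mul_assoc]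
          exact f.2.2.1 h hh _
        · have h1 := f.2.2.2 (b⁻¹ * z * b) (conj_mem_KoneS b.2 hz) (y * b)
          simp only [PSact]
          rw [← h1]
          group
      have h1 := hequiv b f ⟨_, hmem⟩ rfl
      have h2 : φ (⟨_, hmem⟩ - f) = 0 := by
        rw [map_sub, h1, hf, ← sigma'_apply b.2, hv _ hb, sub_self]
      obtain ⟨e, he⟩ := (hker _).1 h2
      have h3 : ∀ y, (f : ↥C.K → 𝔽) (y * b) - (f : ↥C.K → 𝔽) y = e := fun y => congrFun he y
      have h4 := h3 1
      have h5 := f.2.1 b hb 1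
      rw [mul_one] at h5
      rw [one_mul, h5, sub_self] at h4
      rw [← sub_eq_zero, h3, h4]
    obtain ⟨a, e, hae⟩ := eq_add_smul_iwahoriIndicator f hf1
    have h1 : φ (f - a • iwahoriIndicator C 𝔽 1) = 0 := by
      refine (hker _).2 ⟨e, funext fun x => ?_⟩
      show (f : ↥C.K → 𝔽) x - a * (iwahoriIndicator C 𝔽 1 : ↥C.K → 𝔽) x = e
      rw [hae]
      ring
    rw [map_sub, map_smul, hf, sub_eq_zero] at h1
    refine ⟨a, fun h => hv0 ?_, h1⟩
    rw [h1, h, zero_smul]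
  have hstd : ∀ g, stdFn C 𝔽 W σ 1 v g = a • φ (iwahoriIndicator C 𝔽 g) := by
    intro g
    by_cases hg : g ∈ C.K
    · rw [stdFn_apply_of_mem (by rwa [mul_one]), mul_one, sigma'_apply hg, hva, map_smul]
      congr 1
      refine (hequiv _ _ _ (funext fun x => ?_)).symm
      simp [PSact, iwahoriIndicator]
    · rw [stdFn_apply_of_notMem (by rwa [mul_one]), iwahoriIndicator_eq_zero hg, map_zero,
        smul_zero]
  have hlin : Finsupp.linearCombination 𝔽 (stdFn C 𝔽 W σ 1 v) c =
      a • φ (Finsupp.linearCombination 𝔽 (iwahoriIndicator C 𝔽) c) := by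
    rw [Finsupp.apply_linearCombination, Finsupp.linearCombination_apply,
      Finsupp.linearCombination_apply, Finsupp.smul_sum]
    refine Finsupp.sum_congr fun g _ => ?_
    rw [hstd, Function.comp_apply, smul_comm]
  rw [hlin, smul_eq_zero_iff_right ha, hker]
  constructor
  · rintro ⟨e, he⟩
    have key : ∀ k ∈ C.K, cosetSum 𝔽 C.IK k c = e := fun k hk => by
      have := linearCombination_iwahoriIndicator c (⟨k, hk⟩⁻¹ : ↥C.K)
      rw [he] at this
      simpa using this.symm
    intro k hk
    rw [key k hk, key 1 (one_mem _)]
  · intro h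
    exact ⟨_, funext fun x =>
      (linearCombination_iwahoriIndicator c x).trans (h _ (inv_mem x.2))⟩

end Steinberg

section Quotient

open Setting Chamber

variable {S : Setting} {C : Chamber S} {𝔽 : Type} [Field 𝔽] {W : Type} [AddCommGroup W]
  [Module 𝔽 W] {σ : Representation 𝔽 ↥C.K W}

lemma stdFn_mem (g : S.GG) (v : W) : stdFn C 𝔽 W σ g v ∈ IndSub C 𝔽 W σ := by
  refine ⟨fun k hk x => ?_, {g⁻¹}, fun x hx => ?_⟩
  · by_cases h : x * g ∈ C.K
    · have h' : k * x * g ∈ C.K := by rw [mul_assoc]; exact mul_mem hk h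
      rw [stdFn_apply_of_mem h', stdFn_apply_of_mem h, mul_assoc, sigma'_mul_apply hk h,
        sigma'_apply hk]
    · have h' : k * x * g ∉ C.K := by
        rw [mul_assoc]
        exact fun h1 => h ((Subgroup.mul_mem_cancel_left _ hk).1 h1)
      rw [stdFn_apply_of_notMem h', stdFn_apply_of_notMem h, map_zero]
  · refine ⟨x * g, ?_, g⁻¹, Finset.mem_singleton_self _, by group⟩
    by_contra h
    exact hx (stdFn_apply_of_notMem h v)

variable (σ) in
/-- The element `[g, v]` of the compact induction. -/
def stdElt (v : W) (g : S.GG) : ↥(IndSub C 𝔽 W σ) := ⟨stdFn C 𝔽 W σ g v, stdFn_mem g v⟩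

lemma indRep_stdElt (g h : S.GG) (v : W) :
    indRep C 𝔽 W σ g (stdElt σ v h) = stdElt σ v (g * h) :=
  Subtype.ext <| funext fun x => by
    show stdFn C 𝔽 W σ h v (x * g) = stdFn C 𝔽 W σ (g * h) v x
    simp only [stdFn, mul_assoc]

variable (σ) in
/-- The linear map from the group algebra to the compact induction given by acting on `[1, v]`. -/
def stdMap (v : W) : (S.GG →₀ 𝔽) →ₗ[𝔽] ↥(IndSub C 𝔽 W σ) :=
  Finsupp.linearCombination 𝔽 (stdElt σ v)

lemma stdMap_single (v : W) (g : S.GG) (a : 𝔽) :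
    stdMap σ v (Finsupp.single g a) = a • stdElt σ v g :=
  Finsupp.linearCombination_single ..

lemma indRep_stdMap (g : S.GG) (v : W) (c : S.GG →₀ 𝔽) :
    indRep C 𝔽 W σ g (stdMap σ v c) = stdMap σ v (Finsupp.lmapDomain 𝔽 𝔽 (g * ·) c) := by
  induction c using Finsupp.induction_linear with
  | zero => simp
  | add f g hf hg => simp only [map_add, hf, hg]
  | single h a =>
    rw [Finsupp.lmapDomain_apply, Finsupp.mapDomain_single, stdMap_single, stdMap_single, map_smul,
      indRep_stdElt]

lemma stdMap_apply_one (v : W) (c : S.GG →₀ 𝔽) :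
    (stdMap σ v c : S.GG → W) 1 = Finsupp.linearCombination 𝔽 (stdFn C 𝔽 W σ 1 v) c := by
  induction c using Finsupp.induction_linear with
  | zero => simp
  | add f g hf hg => rw [map_add, map_add, ← hf, ← hg]; rfl
  | single g a =>
    rw [stdMap_single, Finsupp.linearCombination_single]
    show a • stdFn C 𝔽 W σ g v 1 = _
    simp only [stdFn, mul_one, one_mul]

lemma cosetSum_lmapDomain {G R : Type*} [Group G] [CommRing R] (X : Set G) (g h : G)
    (c : G →₀ R) :
    cosetSum R X h (Finsupp.lmapDomain R R (g⁻¹ * ·) c) = cosetSum R X (g * h) c := by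
  induction c using Finsupp.induction_linear with
  | zero => simp
  | add f g hf hg => simp only [map_add, hf, hg]
  | single x a =>
    rw [Finsupp.lmapDomain_apply, Finsupp.mapDomain_single, cosetSum_single, cosetSum_single,
      mul_inv_rev, mul_assoc]

/-- The annihilator of `[1, v]`, for `v` a vector of the Steinberg weight fixed by the pro-`p`
Iwahori subgroup. -/
lemma cosetSum_eq_of_stdMap_eq_zero (hst : IsSteinberg C 𝔽 σ) {v : W} (hv0 : v ≠ 0)
    (hv : ∀ g ∈ C.I1, sigma' C 𝔽 W σ g v = v) {c : S.GG →₀ 𝔽} (hc : stdMap σ v c = 0)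
    (h : S.GG) {k : S.GG} (hk : k ∈ C.K) :
    cosetSum 𝔽 C.IK (h * k) c = cosetSum 𝔽 C.IK h c := by
  have h1 := (linearCombination_stdFn_eq_zero_iff hst hv0 hv
    (Finsupp.lmapDomain 𝔽 𝔽 (h⁻¹ * ·) c)).1
    (by rw [← stdMap_apply_one, ← indRep_stdMap, hc, map_zero]; rfl) k hk
  rwa [cosetSum_lmapDomain, cosetSum_lmapDomain, mul_one] at h1

lemma stdElt_mem_range_stdMap (hw : IsWeight C 𝔽 W σ) {v : W} (hv0 : v ≠ 0) (g : S.GG) (w : W) :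
    stdElt σ w g ∈ LinearMap.range (stdMap σ v) := by
  have htop : Submodule.span 𝔽 (Set.range fun k : ↥C.K => σ k v) = ⊤ := by
    refine (hw.2.2.1 _ fun k x hx => ?_).resolve_left fun h => hv0 ?_
    · induction hx using Submodule.span_induction with
      | mem x hx =>
        obtain ⟨l, rfl⟩ := hx
        exact Submodule.subset_span ⟨k * l, by simp⟩
      | zero => simp
      | add x y _ _ hx hy => rw [map_add]; exact add_mem hx hy
      | smul a x _ hx => rw [map_smul]; exact Submodule.smul_mem _ _ hx
    · have h1 : σ 1 v ∈ Submodule.span 𝔽 (Set.range fun k : ↥C.K => σ k v) :=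
        Submodule.subset_span ⟨1, rfl⟩
      rwa [h, Submodule.mem_bot, map_one] at h1
  have hadd : ∀ x y : W, stdElt σ (x + y) g = stdElt σ x g + stdElt σ y g := fun x y =>
    Subtype.ext <| funext fun z => by
      show stdFn C 𝔽 W σ g (x + y) z = stdFn C 𝔽 W σ g x z + stdFn C 𝔽 W σ g y z
      simp only [stdFn]
      split_ifs <;> simp
  have hsmul : ∀ (a : 𝔽) (x : W), stdElt σ (a • x) g = a • stdElt σ x g := fun a x =>
    Subtype.ext <| funext fun z => by
      show stdFn C 𝔽 W σ g (a • x) z = a • stdFn C 𝔽 W σ g x z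
      simp only [stdFn]
      split_ifs <;> simp
  have hmem : w ∈ Submodule.span 𝔽 (Set.range fun k : ↥C.K => σ k v) := htop ▸ Submodule.mem_top
  induction hmem using Submodule.span_induction with
  | mem x hx =>
    obtain ⟨k, rfl⟩ := hx
    refine ⟨Finsupp.single (g * k) 1, ?_⟩
    rw [stdMap_single, one_smul]
    refine Subtype.ext <| funext fun z => ?_
    show stdFn C 𝔽 W σ (g * k) v z = stdFn C 𝔽 W σ g (σ k v) z
    by_cases h : z * g ∈ C.K
    · rw [stdFn_apply_of_mem (by rw [← mul_assoc]; exact mul_mem h k.2), stdFn_apply_of_mem h,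
        ← mul_assoc, sigma'_mul_apply h k.2, sigma'_apply k.2]
    · rw [stdFn_apply_of_notMem h, stdFn_apply_of_notMem]
      rwa [← mul_assoc, Subgroup.mul_mem_cancel_right _ k.2]
  | zero =>
    have h1 := hsmul 0 0
    rw [zero_smul, zero_smul] at h1
    rw [h1]
    exact zero_mem _
  | add x y _ _ hx hy => rw [hadd]; exact add_mem hx hy
  | smul a x _ hx => rw [hsmul]; exact Submodule.smul_mem _ _ hx

lemma stdMap_surjective (hw : IsWeight C 𝔽 W σ) {v : W} (hv0 : v ≠ 0) :
    Function.Surjective (stdMap σ v) := by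
  suffices h : ∀ (s : Finset S.GG) (f : ↥(IndSub C 𝔽 W σ)),
      (∀ g, (f : S.GG → W) g ≠ 0 → ∃ k ∈ C.K, ∃ t ∈ s, g = k * t) →
        f ∈ LinearMap.range (stdMap σ v) by
    intro f
    obtain ⟨s, hs⟩ := f.2.2
    exact h s f hs
  intro s
  induction s using Finset.induction_on with
  | empty =>
    intro f hf
    have h1 : f = 0 := Subtype.ext <| funext fun g => by
      by_contra h
      obtain ⟨_, _, _, ht, _⟩ := hf g h
      exact absurd ht (Finset.notMem_empty _)
    rw [h1]
    exact zero_mem _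
  | insert t s _ ih =>
    intro f hf
    rw [← sub_add_cancel f (stdElt σ ((f : S.GG → W) t) t⁻¹)]
    refine add_mem (ih _ fun g hg => ?_) (stdElt_mem_range_stdMap hw hv0 _ _)
    replace hg : (f : S.GG → W) g - stdFn C 𝔽 W σ t⁻¹ ((f : S.GG → W) t) g ≠ 0 := hg
    by_cases h : g * t⁻¹ ∈ C.K
    · refine absurd ?_ hg
      rw [stdFn_apply_of_mem h, sigma'_apply h, ← f.2.1 _ h, inv_mul_cancel_right, sub_self]
    · rw [stdFn_apply_of_notMem h, sub_zero] at hg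
      obtain ⟨k, hk, u, hu, rfl⟩ := hf g hg
      refine ⟨k, hk, u, (Finset.mem_insert.1 hu).resolve_left ?_, rfl⟩
      rintro rfl
      exact h (by rwa [mul_inv_cancel_right])

lemma coe_vertexGroup_inf :
    ((S.vertexGroup (-C.nK) ⊓ S.vertexGroup (-C.nK + 1) : Subgroup S.GG) : Set S.GG) = C.IK :=
  Set.ext fun _ => mem_IK.symm

lemma stdMap_translateSum_single (v : W) (U : Finset S.GG) (g : S.GG) :
    stdMap σ v (translateSum 𝔽 U (Finsupp.single g 1)) = ∑ l ∈ U, stdElt σ v (g * l) := by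
  rw [translateSum_single, map_sum]
  exact Finset.sum_congr rfl fun l _ => by rw [stdMap_single, one_smul]

lemma lmapDomain_translateSum {G R : Type*} [Group G] [CommRing R] (U : Finset G) (g : G)
    (c : G →₀ R) :
    Finsupp.lmapDomain R R (g * ·) (translateSum R U c) =
      translateSum R U (Finsupp.lmapDomain R R (g * ·) c) := by
  induction c using Finsupp.induction_linear with
  | zero => simp
  | add f g hf hg => simp only [map_add, hf, hg]
  | single x a =>
    rw [translateSum_single, map_sum]
    simp only [Finsupp.lmapDomain_apply, Finsupp.mapDomain_single, translateSum_single, mul_assoc]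

/-- The operator `j` kills the translate by `β_K` of a vector of the Steinberg weight fixed by the
pro-`p` Iwahori subgroup. -/
lemma apply_sigma'_βK_eq_zero (hst : IsSteinberg C 𝔽 σ) {v : W} (hv0 : v ≠ 0)
    (hv : ∀ g ∈ C.I1, sigma' C 𝔽 W σ g v = v) {j : W →ₗ[𝔽] W} (hj : IsJ C 𝔽 W σ j)
    {U V : Finset S.GG} (hU : ∀ u ∈ U, u ∈ S.unipotent ⊓ S.vertexGroup (-C.nK))
    (hV : IsCosetReps (S.vertexGroup (-C.nK)) (S.vertexGroup (-C.nK + 1)) V)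
    (hUV : V = U.image fun u => 1 * u * S.reflection (-C.nK)) (hcard : (V.card : 𝔽) = 0) :
    j (sigma' C 𝔽 W σ C.βK v) = 0 := by
  have hmem : ∀ l ∈ V, l ∈ C.K := fun l hl => mem_K.2 (hV.mem l hl).1
  have h1 : ∀ k ∈ C.K,
      cosetSum 𝔽 C.IK k (Finsupp.single 1 1 + ∑ l ∈ V, Finsupp.single l 1) = 1 := fun k hk => by
    have h2 := hV.sum_ite k (1 : 𝔽)
    have h3 : ∀ l, k⁻¹ * l ∈ C.IK ↔
        l⁻¹ * k ∈ S.vertexGroup (-C.nK) ⊓ S.vertexGroup (-C.nK + 1) := fun l => by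
      rw [mem_IK, ← inv_mem_iff, mul_inv_rev, inv_inv]
    simp only [map_add, map_sum, cosetSum_single, h3]
    rw [h2, inv_one, one_mul, Subgroup.mem_inf]
    have h4 := mem_K.1 hk
    by_cases h5 : k ∈ S.vertexGroup (-C.nK + 1) <;> simp [h4, h5]
  have h4 := (linearCombination_stdFn_eq_zero_iff hst hv0 hv _).2
    fun k hk => (h1 k hk).trans (h1 1 (one_mem _)).symm
  have h5 : ∀ l ∈ C.K, stdFn C 𝔽 W σ 1 v l = sigma' C 𝔽 W σ l v := fun l hl => by
    rw [stdFn_apply_of_mem (by rwa [mul_one]), mul_one]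
  rw [map_add, map_sum, Finsupp.linearCombination_single, one_smul, h5 1 (one_mem _)] at h4
  simp only [Finsupp.linearCombination_single, one_smul] at h4
  rw [Finset.sum_congr rfl fun l hl => h5 l (hmem l hl)] at h4
  have h6 := congrArg (fun x => j (sigma' C 𝔽 W σ C.βK x)) h4
  simp only [map_add, map_sum, map_zero] at h6
  have h7 : ∀ l ∈ V, j (sigma' C 𝔽 W σ C.βK (sigma' C 𝔽 W σ l v)) = v := fun l hl => by
    obtain ⟨u, hu, h8⟩ := Finset.mem_image.1 (hUV ▸ hl)
    have h9 := hj.2 v _ (reflection_conj_mem_I1' (hU u hu))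
    rw [map_sub, sub_eq_zero, hj.1 v hv] at h9
    rw [← sigma'_mul_apply βK_mem (hmem l hl), ← h8, one_mul, ← βK_eq, ← mul_assoc, h9]
  rw [← sigma'_mul_apply βK_mem (one_mem _), mul_one, Finset.sum_congr rfl h7,
    Finset.sum_const, ← Nat.cast_smul_eq_nsmul 𝔽, hcard, zero_smul, add_zero] at h6
  exact h6

lemma hecke_stdElt {v : W} (hv : ∀ g ∈ C.I1, sigma' C 𝔽 W σ g v = v) {j : W →ₗ[𝔽] W}
    (hj : IsJ C 𝔽 W σ j) (hjβ : j (sigma' C 𝔽 W σ C.βK v) = 0)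
    {T : Module.End 𝔽 ↥(IndSub C 𝔽 W σ)} (hT : IsHeckeT C 𝔽 W σ j T) {U₁ U₂ : Finset S.GG}
    (hU₁ : S.IsReps (S.unipotent ⊓ S.vertexGroup (-C.nK) : Subgroup S.GG)
      (S.unipotent ⊓ S.vertexGroup (-C.nK - 1) : Subgroup S.GG) U₁)
    (hU₂ : S.IsReps (S.unipotent ⊓ S.vertexGroup (-C.nK - 1) : Subgroup S.GG)
      (S.unipotent ⊓ S.vertexGroup (-C.nK - 2) : Subgroup S.GG) U₂) :
    T (stdElt σ v 1) = stdMap σ v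
      (translateSum 𝔽 (U₂.image fun u => S.reflection (-C.nK) * u * (S.translation 1)⁻¹)
        (translateSum 𝔽 (U₁.image fun u => 1 * u * S.reflection (-C.nK))
          (Finsupp.single 1 1))) := by
  obtain ⟨hU, hinj⟩ := IsReps.mul (unipotent_inf_mono (by omega)) (unipotent_inf_mono (by omega))
    hU₁ hU₂
  have e1 : ((S.unipotent ⊓ S.vertexGroup (-C.nK - 1) : Subgroup S.GG) : Set S.GG) =
      S.Nk (C.nK + 1) := by rw [← coe_unipotent_inf, neg_add']
  have e2 : ((S.unipotent ⊓ S.vertexGroup (-C.nK - 2) : Subgroup S.GG) : Set S.GG) =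
      S.Nk (C.nK + 2) := by rw [← coe_unipotent_inf, neg_add']
  have hUmem := hU.1
  rw [e2, coe_unipotent_inf] at hU
  rw [e1, e2] at hU₂
  apply Subtype.ext
  rw [hT.2 v (stdElt σ v 1) rfl _ _ hU hU₂, hjβ]
  have h0 : ∀ g, stdFn C 𝔽 W σ g (0 : W) = 0 := fun g => funext fun x => by
    simp [stdFn]
  simp only [h0, Finset.sum_const_zero, add_zero]
  rw [Finset.sum_congr rfl fun u hu => (by
    have h1 := mem_I1_of_unipotent (inv_mem (hUmem hu))
    rw [hv _ h1, hj.1 v hv]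
    rfl :
      stdFn C 𝔽 W σ (u * S.alphaE⁻¹) (j (sigma' C 𝔽 W σ u⁻¹ v)) =
        (stdElt σ v (u * S.alphaE⁻¹) : S.GG → W)), Finset.sum_image hinj, Finset.sum_product,
    translateSum_single, map_sum, map_sum, Finset.sum_image (fun a _ b _ h => by simpa using h)]
  simp only [stdMap_translateSum_single]
  rw [AddSubmonoidClass.coe_finsetSum]
  refine Finset.sum_congr rfl fun a _ => ?_
  rw [Finset.sum_image (fun a _ b _ h => by simpa using h), AddSubmonoidClass.coe_finsetSum]
  refine Finset.sum_congr rfl fun b _ => ?_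
  congr 2
  rw [alphaE_eq, one_mul, one_mul, mul_assoc a, mul_assoc a, mul_assoc (S.reflection _),
    ← mul_assoc (S.reflection _) (S.reflection _), reflection_mul_self, one_mul]

lemma hecke_stdMap {v : W} {j : W →ₗ[𝔽] W} {T : Module.End 𝔽 ↥(IndSub C 𝔽 W σ)}
    (hT : IsHeckeT C 𝔽 W σ j T) {U V : Finset S.GG}
    (h : T (stdElt σ v 1) =
      stdMap σ v (translateSum 𝔽 U (translateSum 𝔽 V (Finsupp.single 1 1)))) (c : S.GG →₀ 𝔽) :
    T (stdMap σ v c) = stdMap σ v (translateSum 𝔽 U (translateSum 𝔽 V c)) := by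
  induction c using Finsupp.induction_linear with
  | zero => simp
  | add f g hf hg => simp only [map_add, hf, hg]
  | single g a =>
    have h1 : Finsupp.single g a = a • Finsupp.lmapDomain 𝔽 𝔽 (g * ·) (Finsupp.single 1 1) := by
      simp
    rw [h1, map_smul, map_smul, map_smul, map_smul, map_smul, ← indRep_stdMap, hT.1,
      stdMap_single, one_smul, h, indRep_stdMap, lmapDomain_translateSum, lmapDomain_translateSum]

lemma reflection_succ_notMem (t : ℤ) : S.reflection (t + 1) ∉ S.vertexGroup t := fun h => by
  have h1 := (unip_mul_reflection_mem (S := S) (one_mem (S.unipotent ⊓ S.vertexGroup (t + 1)))).2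
  rw [one_mul, ← reflection_conj_mem_iff (t := t + 1), reflection_mul_self, one_mul] at h1
  exact h1 (by convert h using 2; ring)

/-- The function `f₁` as an element of the compact induction generated by `[1, v₀]`. -/
lemma eq_stdMap_translateSum {v : W} {ff : ℤ → ↥(IndSub C 𝔽 W σ)} (hff : IsFFamily C 𝔽 W σ v ff)
    {U V : Finset S.GG} (hU : ∀ u ∈ U, u ∈ S.unipotent ⊓ S.vertexGroup (-C.nK - 1))
    (hV : IsCosetReps (S.vertexGroup (-C.nK + 1)) (S.vertexGroup (-C.nK)) V)
    (hUV : V = U.image fun u => S.reflection (-C.nK) * u * (S.translation 1)⁻¹) :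
    ff 1 = stdMap σ v (translateSum 𝔽 V (Finsupp.single 1 1)) := by
  obtain ⟨-, -, hinv, hsupp, hval, -⟩ := hff
  rw [stdMap_translateSum_single]
  refine Subtype.ext <| funext fun x => ?_
  rw [AddSubmonoidClass.coe_finsetSum, Finset.sum_apply]
  simp only [one_mul]
  by_cases hx : ∃ l ∈ V, x * l ∈ C.K
  · obtain ⟨l, hl, hxl⟩ := hx
    rw [Finset.sum_eq_single l _ fun h => absurd hl h]
    · show _ = stdFn C 𝔽 W σ l v x
      obtain ⟨u, hu, rfl⟩ := Finset.mem_image.1 (hUV ▸ hl)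
      have hβ := βK_eq (C := C)
      have h1 : x = x * (S.reflection (-C.nK) * u * (S.translation 1)⁻¹) *
          (C.βK * S.alphaE ^ (-1 : ℤ)) * (C.βK * u⁻¹ * C.βK) := by
        have h2 : C.βK * (S.translation 1)⁻¹ * C.βK = S.translation 1 := by
          rw [hβ, translation_inv, reflection_mul_translation, reflection_mul_reflection]
          congr 1
          ring
        calc x = x * (C.βK * u * (S.translation 1)⁻¹) * (S.translation 1 * u⁻¹ * C.βK) := by
              rw [mul_assoc, ← mul_assoc _ (S.translation 1 * u⁻¹), ← mul_assoc _ (S.translation 1),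
                inv_mul_cancel_right, mul_inv_cancel_right, βK_mul_self, mul_one]
          _ = _ := by
              rw [← hβ, alphaE_eq, zpow_neg_one]
              nth_rewrite 2 [← h2]
              group
      have h2 := hinv 1 _ (reflection_conj_mem_I1 (C := C) (inv_mem (hU u hu)))
      have h3 : (ff 1 : S.GG → W) (C.βK * S.alphaE ^ (-1 : ℤ) * (C.βK * u⁻¹ * C.βK)) = v := by
        have h4 := congrFun (congrArg (fun f : ↥(IndSub C 𝔽 W σ) => (f : S.GG → W)) h2)
          (C.βK * S.alphaE ^ (-1 : ℤ))
        refine h4.trans ?_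
        rw [(ff 1).2.1 _ βK_mem, hval 1 one_pos, ← sigma'_apply βK_mem,
          ← sigma'_mul_apply βK_mem βK_mem, βK_mul_self, sigma'_apply (one_mem _)]
        exact congrArg (fun f : Module.End 𝔽 W => f v) (map_one σ)
      rw [stdFn_apply_of_mem hxl, sigma'_apply hxl]
      nth_rewrite 1 [h1]
      rw [mul_assoc, (ff 1).2.1 _ hxl, h3]
    · intro m hm hml
      refine stdFn_apply_of_notMem (fun hxm => hml ?_) v
      obtain ⟨hlL, hlK⟩ := hV.mem l hl
      refine (hV.existsUnique l hlL hlK).unique ⟨hm, ?_⟩ ⟨hl, by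
        rw [inv_mul_cancel]; exact one_mem _⟩
      refine Subgroup.mem_inf.2 ⟨mul_mem (inv_mem (hV.mem m hm).1) hlL, mem_K.1 ?_⟩
      have h1 := mul_mem (inv_mem hxm) hxl
      rwa [mul_inv_rev, mul_assoc, inv_mul_cancel_left] at h1
  · push Not at hx
    have h0 : ∀ l ∈ V, (stdElt σ v l : S.GG → W) x = 0 := fun l hl =>
      stdFn_apply_of_notMem (hx l hl) v
    rw [Finset.sum_eq_zero h0]
    by_contra h
    obtain ⟨k, hk, i, hi, rfl⟩ := hsupp 1 x h
    obtain ⟨hiK, hiL⟩ := mem_IK.1 (mem_I1.1 hi).1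
    have h1 : S.alphaE ^ (-1 : ℤ) = C.βK * S.reflection (-C.nK + 1) := by
      rw [βK_eq, alphaE_eq, zpow_neg_one, translation_inv, reflection_mul_reflection]
      congr 1
      ring
    obtain ⟨l, ⟨hl, hlK⟩, -⟩ := hV.existsUnique (i⁻¹ * S.reflection (-C.nK + 1))
      (mul_mem (inv_mem hiL) (reflection_mem _)) fun h2 =>
        reflection_succ_notMem _ ((Subgroup.mul_mem_cancel_left _ (inv_mem hiK)).1 h2)
    refine hx l hl ?_
    have h2 := inv_mem (mem_K.2 (Subgroup.mem_inf.1 hlK).2)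
    rw [mul_inv_rev, mul_inv_rev, inv_inv, inv_inv, reflection_inv] at h2
    rw [h1]
    have h3 := mul_mem (mul_mem hk βK_mem) h2
    simpa only [mul_assoc] using h3

end Quotient

lemma natCast_eq_zero_of_dvd {p n : ℕ} {𝔽 : Type*} [Field 𝔽] [Algebra (ZMod p) 𝔽] (h : p ∣ n) :
    (n : 𝔽) = 0 := by
  rw [← map_natCast (algebraMap (ZMod p) 𝔽), (ZMod.natCast_eq_zero_iff n p).2 h, map_zero]

/-- The image of `f₁` in `(ind_K^G st)/(T)` is nonzero but does not
generate `(ind_K^G st)/(T)`. -/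
theorem stmt4
    (S : Setting) (C : Chamber S)
    (𝔽 : Type) [Field 𝔽] [IsAlgClosed 𝔽] [Algebra (ZMod S.p) 𝔽]
    [Algebra.IsAlgebraic (ZMod S.p) 𝔽]
    (Wst : Type) [AddCommGroup Wst] [Module 𝔽 Wst]
    (σst : Representation 𝔽 ↥C.K Wst)
    (hstweight : IsWeight C 𝔽 Wst σst) (hst : IsSteinberg C 𝔽 σst)
    (v0 : Wst) (ff : ℤ → ↥(IndSub C 𝔽 Wst σst)) (hff : IsFFamily C 𝔽 Wst σst v0 ff)
    (jst : Wst →ₗ[𝔽] Wst) (hjst : IsJ C 𝔽 Wst σst jst)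
    (Tst : Module.End 𝔽 ↥(IndSub C 𝔽 Wst σst)) (hTst : IsHeckeT C 𝔽 Wst σst jst Tst) :
    ff 1 ∉ LinearMap.range Tst ∧
    orbitSpan 𝔽 (indRep C 𝔽 Wst σst) (ff 1) ⊔ LinearMap.range Tst ≠ ⊤ := by
  obtain ⟨hv0, hv, -⟩ := id hff
  obtain ⟨U₁, hU₁, hp₁⟩ := Setting.exists_unipotent_reps (S := S) (-C.nK)
  obtain ⟨U₂, hU₂, hp₂⟩ := Setting.exists_unipotent_reps (S := S) (-C.nK - 1)
  rw [show -C.nK - 1 - 1 = -C.nK - 2 by ring] at hU₂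
  have hV := Setting.isCosetReps_vertexGroup hU₁
  have hU := Setting.isCosetReps_vertexGroup_succ hU₂
  have hVcard : ((U₁.image fun u => 1 * u * S.reflection (-C.nK)).card : 𝔽) = 0 := by
    rw [Finset.card_image_of_injective _ fun a b h => by simpa using h]
    exact natCast_eq_zero_of_dvd hp₁
  have hUcard :
      ((U₂.image fun u => S.reflection (-C.nK) * u * (S.translation 1)⁻¹).card : 𝔽) = 0 := by
    rw [Finset.card_image_of_injective _ fun a b h => by simpa using h]
    exact natCast_eq_zero_of_dvd hp₂
  have hT := hecke_stdMap hTst (hecke_stdElt hv hjst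
    (apply_sigma'_βK_eq_zero hst hv0 hv hjst (fun u hu => hU₁.1 hu) hV rfl hVcard) hTst hU₁ hU₂)
  have hf := eq_stdMap_translateSum hff (fun u hu => hU₂.1 hu) hU rfl
  have hker := fun c => cosetSum_eq_of_stdMap_eq_zero (c := c) hst hv0 hv
  have hsurj := stdMap_surjective hstweight hv0
  set U := U₂.image fun u => S.reflection (-C.nK) * u * (S.translation 1)⁻¹
  set V := U₁.image fun u => 1 * u * S.reflection (-C.nK)
  have hD := Setting.descends_vertexGroup (S := S) (-C.nK)
  have hD' := Setting.descends_vertexGroup_succ (S := S) (-C.nK)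
  rw [← coe_vertexGroup_inf] at hker
  constructor
  · rintro ⟨x, hx⟩
    obtain ⟨c, rfl⟩ := hsurj x
    refine hD.translateSum_single_sub_not_invariant hD' hU hUcard hV hVcard c fun h k hk => ?_
    refine hker _ ?_ h (Chamber.mem_K.2 hk)
    rw [map_sub, map_sub, ← hf, ← hT, hx, sub_self]
  · intro htop
    have hle : orbitSpan 𝔽 (indRep C 𝔽 Wst σst) (ff 1) ⊔ LinearMap.range Tst ≤
        LinearMap.range (stdMap σst v0 ∘ₗ translateSum 𝔽 U) := by
      refine sup_le (Submodule.span_le.2 ?_) ?_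
      · rintro _ ⟨g, rfl⟩
        rw [hf, indRep_stdMap, lmapDomain_translateSum]
        exact ⟨_, rfl⟩
      · rintro _ ⟨x, rfl⟩
        obtain ⟨c, rfl⟩ := hsurj x
        exact ⟨translateSum 𝔽 V c, (hT c).symm⟩
    obtain ⟨c, hc⟩ := hle (htop ▸ Submodule.mem_top : stdElt σst v0 1 ∈ _)
    refine hD.single_sub_translateSum_not_invariant hU hUcard c fun h k hk => ?_
    refine hker _ ?_ h (Chamber.mem_K.2 hk)
    rw [map_sub, stdMap_single, one_smul, ← hc, LinearMap.comp_apply, sub_self]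

end U21
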